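/- arXiv:0801.1585 — 2 statements merged into one kernel-verified Lean document; each statement's English description precedes it below -/
import Mathlib

section
/- Let R = ℂ[X₁₂, X₂₃, X₃₄, X₄₅, X₅₆, X₆₁, X₁₃, X₃₅, X₅₁, X₂₄, X₄₆, X₆₂] graded by assigning weight 1 to X₁₂, X₂₃, X₃₄, X₄₅, X₅₆, X₆₁ and weight 2 to X₁₃, X₃₅, X₅₁, X₂₄, X₄₆, X₆₂, and let J ⊆ R be the ideal generated by the nine weighted-degree-4 polynomials X₂₃X₅₆X₆₂ − X₁₃X₅₁, X₃₄X₆₁X₄₆ − X₃₅X₅₁, X₁₂X₄₅X₂₄ − X₁₃X₃₅, X₁₂X₄₅X₅₁ − X₄₆X₆₂, X₂₃X₅₆X₃₅ − X₂₄X₄₆, X₃₄X₆₁X₁₃ − X₂₄X₆₂, X₂₃X₃₄X₅₆X₆₁ − X₅₁X₂₄, X₁₂X₃₄X₄₅X₆₁ − X₃₅X₆₂, X₁₂X₂₃X₄₅X₅₆ − X₁₃X₄₆ cutting out the coherent component of the dP₃ master space. Then the Hilbert series of R/J (with respect to this weighted grading) satisfies (Σ_{n≥0} h(n) tⁿ)·(1−t)⁶(1−t²)⁶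 = 1 − 9t⁴ + 16t⁶ − 9t⁸ + t¹²; i.e. H(t; F_irr(dP₃)) = (1 + 4t² + t⁴)/((1−t)⁸(1+t)²). Note the numerator is palindromic, reflecting that the coherent component is Calabi–Yau of dimension 8. -/
open MvPolynomial

namespace DP3CoherentHilbert

-- R = ℂ[X₁₂, X₂₃, X₃₄, X₄₅, X₅₆, X₆₁, X₁₃, X₃₅, X₅₁, X₂₄, X₄₆, X₆₂]
noncomputable def X₁₂ : MvPolynomial (Fin 12) ℂ := X 0
noncomputable def X₂₃ : MvPolynomial (Fin 12) ℂ := X 1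
noncomputable def X₃₄ : MvPolynomial (Fin 12) ℂ := X 2
noncomputable def X₄₅ : MvPolynomial (Fin 12) ℂ := X 3
noncomputable def X₅₆ : MvPolynomial (Fin 12) ℂ := X 4
noncomputable def X₆₁ : MvPolynomial (Fin 12) ℂ := X 5
noncomputable def X₁₃ : MvPolynomial (Fin 12) ℂ := X 6
noncomputable def X₃₅ : MvPolynomial (Fin 12) ℂ := X 7
noncomputable def X₅₁ : MvPolynomial (Fin 12) ℂ := X 8
noncomputable def X₂₄ : MvPolynomial (Fin 12) ℂ := X 9
noncomputable def X₄₆ : MvPolynomial (Fin 12) ℂ := X 10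
noncomputable def X₆₂ : MvPolynomial (Fin 12) ℂ := X 11

/-- The grading: weight 1 for `X₁₂, X₂₃, X₃₄, X₄₅, X₅₆, X₆₁` and weight 2 for
`X₁₃, X₃₅, X₅₁, X₂₄, X₄₆, X₆₂`. -/
def w : Fin 12 → ℕ := fun i => if i ≤ 5 then 1 else 2

/-- The ideal cutting out the coherent component of the `dP₃` master space,
generated by the nine listed weighted-degree-4 polynomials. -/
noncomputable def J : Ideal (MvPolynomial (Fin 12) ℂ) :=
  Ideal.span
    {X₂₃ * X₅₆ * X₆₂ - X₁₃ * X₅₁, X₃₄ * X₆₁ * X₄₆ - X₃₅ * X₅₁,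
      X₁₂ * X₄₅ * X₂₄ - X₁₃ * X₃₅, X₁₂ * X₄₅ * X₅₁ - X₄₆ * X₆₂,
      X₂₃ * X₅₆ * X₃₅ - X₂₄ * X₄₆, X₃₄ * X₆₁ * X₁₃ - X₂₄ * X₆₂,
      X₂₃ * X₃₄ * X₅₆ * X₆₁ - X₅₁ * X₂₄, X₁₂ * X₃₄ * X₄₅ * X₆₁ - X₃₅ * X₆₂,
      X₁₂ * X₂₃ * X₄₅ * X₅₆ - X₁₃ * X₄₆}

/-- The Hilbert function of `R/J` with respect to the weighted grading `w`:
`h(n) = dim_ℂ R_n/(J ∩ R_n)` where `R_n` is the weighted-degree-`n` piece. -/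
noncomputable def h (n : ℕ) : ℕ :=
  Module.finrank ℂ
    ((weightedHomogeneousSubmodule ℂ w n).map (Ideal.Quotient.mkₐ ℂ J).toLinearMap)


/-! ### Counting normal forms -/

/-- Exponent labels of the normal form monomials in the weight-2 variables having degree `k`. -/
def Yk (k : ℕ) : Finset (Fin 6 × ℕ × ℕ) :=
  if k = 0 then {(0, 0, 0)} else Finset.univ ×ˢ ({k} ×ˢ Finset.range k)

def Y (j : ℕ) : Finset (Fin 6 × ℕ × ℕ) := if j % 2 = 0 then Yk (j / 2) else ∅

abbrev Idx := (Fin 6 →₀ ℕ) × (Fin 6 × ℕ × ℕ)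

noncomputable def In (n : ℕ) : Finset Idx :=
  (Finset.HasAntidiagonal.antidiagonal n).biUnion fun p => Finset.finsuppAntidiag Finset.univ p.1 ×ˢ Y p.2

lemma mem_Yk {k : ℕ} {y : Fin 6 × ℕ × ℕ} :
    y ∈ Yk k ↔ y.2.1 = k ∧ ((k = 0 ∧ y = (0, 0, 0)) ∨ y.2.2 < k) := by
  obtain ⟨i, a, b⟩ := y
  unfold Yk
  split_ifs with hk
  · subst hk; simp; tauto
  · simp [hk]; tauto

lemma mem_Y {j : ℕ} {y : Fin 6 × ℕ × ℕ} :
    y ∈ Y j ↔ 2 * y.2.1 = j ∧ (y = (0, 0, 0) ∨ y.2.2 < y.2.1) := by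
  obtain ⟨i, a, b⟩ := y
  unfold Y
  split_ifs with hj
  · rw [mem_Yk]
    simp only [Prod.mk.injEq]
    omega
  · simp; intro hh; omega

lemma mem_In {n : ℕ} {u : Idx} :
    u ∈ In n ↔ (∑ i, u.1 i) + 2 * u.2.2.1 = n ∧
      (u.2 = (0, 0, 0) ∨ u.2.2.2 < u.2.2.1) := by
  unfold In
  simp only [Finset.mem_biUnion, Finset.HasAntidiagonal.mem_antidiagonal, Finset.mem_product,
    Finset.mem_finsuppAntidiag, mem_Y]
  constructor
  · rintro ⟨⟨p, q⟩, h1, ⟨h2, -⟩, h3, h4⟩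
    simp only at *
    exact ⟨by rw [← h1, ← h2, ← h3], h4⟩
  · rintro ⟨h1, h2⟩
    exact ⟨(_, _), h1, ⟨rfl, by simp⟩, rfl, h2⟩

lemma card_Y (j : ℕ) : (Y j).card = if j = 0 then 1 else if j % 2 = 0 then 3 * j else 0 := by
  unfold Y Yk
  by_cases h0 : j = 0
  · subst h0; simp
  by_cases h2 : j % 2 = 0
  · have : j / 2 ≠ 0 := by omega
    simp only [h2, h0, this, if_true, if_false, Finset.card_product, Finset.card_univ,
      Fintype.card_fin, Finset.card_singleton, Finset.card_range]
    omega
  · simp [h0, h2]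

lemma card_In (n : ℕ) : (In n).card = ∑ p ∈ Finset.HasAntidiagonal.antidiagonal n,
    (Finset.finsuppAntidiag (Finset.univ : Finset (Fin 6)) p.1).card * (Y p.2).card := by
  unfold In
  rw [Finset.card_biUnion]
  · simp only [Finset.card_product]
  · rintro ⟨a, b⟩ hp ⟨c, d⟩ hq hne
    rw [Function.onFun, Finset.disjoint_left]
    rintro u hu hv
    simp only [Finset.mem_product, Finset.mem_finsuppAntidiag, mem_Y] at hu hv
    apply hne
    rw [← hu.1.1, ← hv.1.1, ← hu.2.1, ← hv.2.1]

lemma series_x : (PowerSeries.mk fun n =>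
    ((Finset.finsuppAntidiag (Finset.univ : Finset (Fin 6)) n).card : ℤ))
      * (1 - PowerSeries.X) ^ 6 = 1 := by
  have h1 : (PowerSeries.mk fun n =>
      ((Finset.finsuppAntidiag (Finset.univ : Finset (Fin 6)) n).card : ℤ))
      = (PowerSeries.mk 1) ^ 6 := by
    ext n
    have := PowerSeries.coeff_prod (R := ℤ) (fun _ : Fin 6 => PowerSeries.mk 1) n Finset.univ
    simp only [Finset.prod_const, Finset.card_univ, Fintype.card_fin] at this
    rw [this]
    simp
  rw [h1, ← mul_pow, PowerSeries.mk_one_mul_one_sub_eq_one, one_pow]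

lemma series_y : (PowerSeries.mk fun n => ((Y n).card : ℤ))
      * (1 - PowerSeries.X ^ 2) ^ 2 = 1 + 4 * PowerSeries.X ^ 2 + PowerSeries.X ^ 4 := by
  have e : (1 - PowerSeries.X ^ 2 : PowerSeries ℤ) ^ 2
      = 1 - PowerSeries.C 2 * PowerSeries.X ^ 2 + PowerSeries.X ^ 4 := by
    have : (PowerSeries.C 2 : PowerSeries ℤ) = 2 := by simp
    rw [this]; ring
  have e4 : (4 : PowerSeries ℤ) = PowerSeries.C 4 := by simp
  rw [e, e4, mul_add, mul_sub, mul_one, mul_left_comm]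
  ext n
  simp only [map_add, map_sub, PowerSeries.coeff_C_mul, PowerSeries.coeff_mul_X_pow',
    PowerSeries.coeff_mk, PowerSeries.coeff_X_pow, PowerSeries.coeff_one, PowerSeries.coeff_C, card_Y]
  by_cases hn : n < 6
  · interval_cases n <;> simp
  · obtain ⟨m, rfl⟩ : ∃ m, n = m + 6 := ⟨n - 6, by omega⟩
    have h1 : m + 6 - 2 = m + 4 := by omega
    have h2 : m + 6 - 4 = m + 2 := by omega
    have h3 : (m + 6) % 2 = m % 2 := by omega
    have h4 : (m + 4) % 2 = m % 2 := by omega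
    have h5 : (m + 2) % 2 = m % 2 := by omega
    have h6 : 2 ≤ m + 6 := by omega
    have h7 : 4 ≤ m + 6 := by omega
    simp only [h1, h2, h3, h4, h5, h6, h7, if_true]
    by_cases hm : m % 2 = 0
    · simp [hm]; ring
    · simp [hm]

lemma series_In : (PowerSeries.mk fun n => ((In n).card : ℤ))
        * (1 - PowerSeries.X) ^ 6 * (1 - PowerSeries.X ^ 2) ^ 6
      = 1 - 9 * PowerSeries.X ^ 4 + 16 * PowerSeries.X ^ 6
        - 9 * PowerSeries.X ^ 8 + PowerSeries.X ^ 12 := by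
  have h1 : (PowerSeries.mk fun n => ((In n).card : ℤ)) = (PowerSeries.mk fun n =>
    ((Finset.finsuppAntidiag (Finset.univ : Finset (Fin 6)) n).card : ℤ)) *
      (PowerSeries.mk fun n => ((Y n).card : ℤ)) := by
    ext n
    rw [PowerSeries.coeff_mul]
    simp [card_In]
  rw [h1]
  linear_combination ((PowerSeries.mk fun n => ((Y n).card : ℤ)) * (1 - PowerSeries.X ^ 2) ^ 6) *
    series_x + (1 - PowerSeries.X ^ 2) ^ 4 * series_y

/-! ### Monomials -/

/-- The `i`-th coordinate in the quotient ring. -/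
noncomputable def z (i : Fin 12) : MvPolynomial (Fin 12) ℂ ⧸ J := Ideal.Quotient.mkₐ ℂ J (X i)

/-- Monomial in twelve commuting elements with given exponents. -/
def mon {S : Type*} [CommRing S] (v : Fin 12 → S) (x y : Fin 6 → ℕ) : S :=
  (v 0 ^ x 0 * v 1 ^ x 1 * v 2 ^ x 2 * v 3 ^ x 3 * v 4 ^ x 4 * v 5 ^ x 5) *
  (v 6 ^ y 0 * v 7 ^ y 1 * v 8 ^ y 2 * v 9 ^ y 3 * v 10 ^ y 4 * v 11 ^ y 5)

/-- Exponents of the normal forms: two neighbours in the hexagon of variables. -/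
def nfy : Fin 6 → ℕ → ℕ → (Fin 6 → ℕ)
  | 0, r, s => ![r, 0, 0, s, 0, 0]
  | 1, r, s => ![0, s, 0, r, 0, 0]
  | 2, r, s => ![0, r, 0, 0, s, 0]
  | 3, r, s => ![0, 0, s, 0, r, 0]
  | 4, r, s => ![0, 0, r, 0, 0, s]
  | 5, r, s => ![s, 0, 0, 0, 0, r]

def yexp (y : Fin 6 × ℕ × ℕ) : Fin 6 → ℕ := nfy y.1 (y.2.1 - y.2.2) y.2.2

noncomputable def g (u : Idx) : MvPolynomial (Fin 12) ℂ ⧸ J := mon z u.1 (yexp u.2)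

lemma rels : z 1 * z 4 * z 11 = z 6 * z 8 ∧ z 2 * z 5 * z 10 = z 7 * z 8 ∧
    z 0 * z 3 * z 9 = z 6 * z 7 ∧ z 0 * z 3 * z 8 = z 10 * z 11 ∧
    z 1 * z 4 * z 7 = z 9 * z 10 ∧ z 2 * z 5 * z 6 = z 9 * z 11 ∧
    z 1 * z 2 * z 4 * z 5 = z 8 * z 9 ∧ z 0 * z 2 * z 3 * z 5 = z 7 * z 11 ∧
    z 0 * z 1 * z 3 * z 4 = z 6 * z 10 := by
  unfold z
  simp only [← map_mul]
  refine ⟨?_, ?_, ?_, ?_, ?_, ?_, ?_, ?_, ?_⟩ <;>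
  · refine Ideal.Quotient.eq.2 (Ideal.subset_span ?_)
    simp only [X₁₂, X₂₃, X₃₄, X₄₅, X₅₆, X₆₁, X₁₃, X₃₅, X₅₁, X₂₄, X₄₆, X₆₂,
      Set.mem_insert_iff, Set.mem_singleton_iff, true_or, or_true]

/-- Monomials without forbidden pairs are normal forms. -/
lemma normal_case (y : Fin 6 → ℕ) (h1 : y 0 = 0 ∨ y 2 = 0) (h2 : y 1 = 0 ∨ y 2 = 0)
    (h3 : y 0 = 0 ∨ y 1 = 0) (h4 : y 4 = 0 ∨ y 5 = 0) (h5 : y 3 = 0 ∨ y 4 = 0)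
    (h6 : y 3 = 0 ∨ y 5 = 0) (h7 : y 2 = 0 ∨ y 3 = 0) (h8 : y 1 = 0 ∨ y 5 = 0)
    (h9 : y 0 = 0 ∨ y 4 = 0) :
    ∃ u : Fin 6 × ℕ × ℕ, (u = (0, 0, 0) ∨ u.2.2 < u.2.1) ∧ yexp u = y ∧ u.2.1 = ∑ i, y i := by
  have key : ∀ (i : Fin 6) (r s : ℕ), 0 < r → nfy i r s = y → 
      ∃ u : Fin 6 × ℕ × ℕ, (u = (0, 0, 0) ∨ u.2.2 < u.2.1) ∧ yexp u = y ∧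
        u.2.1 = ∑ i, y i := by
    intro i r s hr hy
    refine ⟨(i, r + s, s), Or.inr (by simp only; omega), by simp [yexp, hy], ?_⟩
    subst hy
    fin_cases i <;> simp [nfy, Fin.sum_univ_succ] <;> omega
  have hext : ∀ v : Fin 6 → ℕ, v 0 = y 0 → v 1 = y 1 → v 2 = y 2 → v 3 = y 3 → v 4 = y 4 →
      v 5 = y 5 → v = y := by
    intro v a b c d e f
    ext i
    fin_cases i <;> assumption
  by_cases ha : 0 < y 0 ∧ y 5 = 0
  · exact key 0 (y 0) (y 3) ha.1 (by apply hext <;> simp [nfy] <;> omega)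
  by_cases hd : 0 < y 3 ∧ y 0 = 0
  · exact key 1 (y 3) (y 1) hd.1 (by apply hext <;> simp [nfy] <;> omega)
  by_cases hb : 0 < y 1 ∧ y 3 = 0
  · exact key 2 (y 1) (y 4) hb.1 (by apply hext <;> simp [nfy] <;> omega)
  by_cases he : 0 < y 4 ∧ y 1 = 0
  · exact key 3 (y 4) (y 2) he.1 (by apply hext <;> simp [nfy] <;> omega)
  by_cases hc : 0 < y 2 ∧ y 4 = 0
  · exact key 4 (y 2) (y 5) hc.1 (by apply hext <;> simp [nfy] <;> omega)
  by_cases hf : 0 < y 5 ∧ y 2 = 0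
  · exact key 5 (y 5) (y 0) hf.1 (by apply hext <;> simp [nfy] <;> omega)
  have h0 : nfy 0 0 0 = y := by apply hext <;> simp [nfy] <;> omega
  refine ⟨(0, 0, 0), Or.inl rfl, h0, ?_⟩
  subst h0
  simp [nfy, Fin.sum_univ_succ]

/-- One rewriting step: what has to be checked about the new exponents. -/
lemma reduce (N : ℕ) : ∀ (x y : Fin 6 → ℕ), ∑ i, y i = N →
    ∃ u ∈ In (∑ i, x i + 2 * ∑ i, y i), mon z x y = g u := by
  obtain ⟨r1, r2, r3, r4, r5, r6, r7, r8, r9⟩ := rels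
  induction N using Nat.strong_induction_on with
  | _ N ih =>
  intro x y hN
  -- a reduction step along a relation
  have step : ∀ (x' y' : Fin 6 → ℕ), ∑ i, y' i < ∑ i, y i →
      ∑ i, x' i + 2 * ∑ i, y' i = ∑ i, x i + 2 * ∑ i, y i → mon z x y = mon z x' y' →
      ∃ u ∈ In (∑ i, x i + 2 * ∑ i, y i), mon z x y = g u := by
    intro x' y' hlt hw he
    rw [he, ← hw]
    exact ih _ (hN ▸ hlt) x' y' rfl
  obtain ⟨x0, x1, x2, x3, x4, x5, hx⟩ : ∃ x0 x1 x2 x3 x4 x5, x = ![x0, x1, x2, x3, x4, x5] :=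
    ⟨x 0, x 1, x 2, x 3, x 4, x 5, by ext i; fin_cases i <;> rfl⟩
  obtain ⟨a, b, c, d, e, f, hy⟩ : ∃ a b c d e f, y = ![a, b, c, d, e, f] :=
    ⟨y 0, y 1, y 2, y 3, y 4, y 5, by ext i; fin_cases i <;> rfl⟩
  by_cases c0 : 0 < y 0 ∧ 0 < y 2
  · subst hx hy
    simp at c0
    obtain ⟨a, rfl⟩ := Nat.exists_eq_add_one.2 c0.1
    obtain ⟨c, rfl⟩ := Nat.exists_eq_add_one.2 c0.2
    refine step ![x0, x1 + 1, x2, x3, x4 + 1, x5] ![a, b, c, d, e, f + 1] ?_ ?_ ?_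
    · simp [Fin.sum_univ_succ]; try omega
    · simp [Fin.sum_univ_succ]; omega
    · simp only [mon, Matrix.cons_val]
      linear_combination -(z 0 ^ x0 * z 1 ^ x1 * z 2 ^ x2 * z 3 ^ x3 * z 4 ^ x4 * z 5 ^ x5 * z 6 ^ a * z 7 ^ b * z 8 ^ c * z 9 ^ d * z 10 ^ e * z 11 ^ f) * r1
  by_cases c1 : 0 < y 1 ∧ 0 < y 2
  · subst hx hy
    simp at c1
    obtain ⟨b, rfl⟩ := Nat.exists_eq_add_one.2 c1.1
    obtain ⟨c, rfl⟩ := Nat.exists_eq_add_one.2 c1.2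
    refine step ![x0, x1, x2 + 1, x3, x4, x5 + 1] ![a, b, c, d, e + 1, f] ?_ ?_ ?_
    · simp [Fin.sum_univ_succ]; try omega
    · simp [Fin.sum_univ_succ]; omega
    · simp only [mon, Matrix.cons_val]
      linear_combination -(z 0 ^ x0 * z 1 ^ x1 * z 2 ^ x2 * z 3 ^ x3 * z 4 ^ x4 * z 5 ^ x5 * z 6 ^ a * z 7 ^ b * z 8 ^ c * z 9 ^ d * z 10 ^ e * z 11 ^ f) * r2
  by_cases c2 : 0 < y 0 ∧ 0 < y 1
  · subst hx hy
    simp at c2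
    obtain ⟨a, rfl⟩ := Nat.exists_eq_add_one.2 c2.1
    obtain ⟨b, rfl⟩ := Nat.exists_eq_add_one.2 c2.2
    refine step ![x0 + 1, x1, x2, x3 + 1, x4, x5] ![a, b, c, d + 1, e, f] ?_ ?_ ?_
    · simp [Fin.sum_univ_succ]; try omega
    · simp [Fin.sum_univ_succ]; omega
    · simp only [mon, Matrix.cons_val]
      linear_combination -(z 0 ^ x0 * z 1 ^ x1 * z 2 ^ x2 * z 3 ^ x3 * z 4 ^ x4 * z 5 ^ x5 * z 6 ^ a * z 7 ^ b * z 8 ^ c * z 9 ^ d * z 10 ^ e * z 11 ^ f) * r3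
  by_cases c3 : 0 < y 4 ∧ 0 < y 5
  · subst hx hy
    simp at c3
    obtain ⟨e, rfl⟩ := Nat.exists_eq_add_one.2 c3.1
    obtain ⟨f, rfl⟩ := Nat.exists_eq_add_one.2 c3.2
    refine step ![x0 + 1, x1, x2, x3 + 1, x4, x5] ![a, b, c + 1, d, e, f] ?_ ?_ ?_
    · simp [Fin.sum_univ_succ]; try omega
    · simp [Fin.sum_univ_succ]; omega
    · simp only [mon, Matrix.cons_val]
      linear_combination -(z 0 ^ x0 * z 1 ^ x1 * z 2 ^ x2 * z 3 ^ x3 * z 4 ^ x4 * z 5 ^ x5 * z 6 ^ a * z 7 ^ b * z 8 ^ c * z 9 ^ d * z 10 ^ e * z 11 ^ f) * r4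
  by_cases c4 : 0 < y 3 ∧ 0 < y 4
  · subst hx hy
    simp at c4
    obtain ⟨d, rfl⟩ := Nat.exists_eq_add_one.2 c4.1
    obtain ⟨e, rfl⟩ := Nat.exists_eq_add_one.2 c4.2
    refine step ![x0, x1 + 1, x2, x3, x4 + 1, x5] ![a, b + 1, c, d, e, f] ?_ ?_ ?_
    · simp [Fin.sum_univ_succ]; try omega
    · simp [Fin.sum_univ_succ]; omega
    · simp only [mon, Matrix.cons_val]
      linear_combination -(z 0 ^ x0 * z 1 ^ x1 * z 2 ^ x2 * z 3 ^ x3 * z 4 ^ x4 * z 5 ^ x5 * z 6 ^ a * z 7 ^ b * z 8 ^ c * z 9 ^ d * z 10 ^ e * z 11 ^ f) * r5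
  by_cases c5 : 0 < y 3 ∧ 0 < y 5
  · subst hx hy
    simp at c5
    obtain ⟨d, rfl⟩ := Nat.exists_eq_add_one.2 c5.1
    obtain ⟨f, rfl⟩ := Nat.exists_eq_add_one.2 c5.2
    refine step ![x0, x1, x2 + 1, x3, x4, x5 + 1] ![a + 1, b, c, d, e, f] ?_ ?_ ?_
    · simp [Fin.sum_univ_succ]; try omega
    · simp [Fin.sum_univ_succ]; omega
    · simp only [mon, Matrix.cons_val]
      linear_combination -(z 0 ^ x0 * z 1 ^ x1 * z 2 ^ x2 * z 3 ^ x3 * z 4 ^ x4 * z 5 ^ x5 * z 6 ^ a * z 7 ^ b * z 8 ^ c * z 9 ^ d * z 10 ^ e * z 11 ^ f) * r6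
  by_cases c6 : 0 < y 2 ∧ 0 < y 3
  · subst hx hy
    simp at c6
    obtain ⟨c, rfl⟩ := Nat.exists_eq_add_one.2 c6.1
    obtain ⟨d, rfl⟩ := Nat.exists_eq_add_one.2 c6.2
    refine step ![x0, x1 + 1, x2 + 1, x3, x4 + 1, x5 + 1] ![a, b, c, d, e, f] ?_ ?_ ?_
    · simp [Fin.sum_univ_succ]; try omega
    · simp [Fin.sum_univ_succ]; omega
    · simp only [mon, Matrix.cons_val]
      linear_combination -(z 0 ^ x0 * z 1 ^ x1 * z 2 ^ x2 * z 3 ^ x3 * z 4 ^ x4 * z 5 ^ x5 * z 6 ^ a * z 7 ^ b * z 8 ^ c * z 9 ^ d * z 10 ^ e * z 11 ^ f) * r7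
  by_cases c7 : 0 < y 1 ∧ 0 < y 5
  · subst hx hy
    simp at c7
    obtain ⟨b, rfl⟩ := Nat.exists_eq_add_one.2 c7.1
    obtain ⟨f, rfl⟩ := Nat.exists_eq_add_one.2 c7.2
    refine step ![x0 + 1, x1, x2 + 1, x3 + 1, x4, x5 + 1] ![a, b, c, d, e, f] ?_ ?_ ?_
    · simp [Fin.sum_univ_succ]; try omega
    · simp [Fin.sum_univ_succ]; omega
    · simp only [mon, Matrix.cons_val]
      linear_combination -(z 0 ^ x0 * z 1 ^ x1 * z 2 ^ x2 * z 3 ^ x3 * z 4 ^ x4 * z 5 ^ x5 * z 6 ^ a * z 7 ^ b * z 8 ^ c * z 9 ^ d * z 10 ^ e * z 11 ^ f) * r8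
  by_cases c8 : 0 < y 0 ∧ 0 < y 4
  · subst hx hy
    simp at c8
    obtain ⟨a, rfl⟩ := Nat.exists_eq_add_one.2 c8.1
    obtain ⟨e, rfl⟩ := Nat.exists_eq_add_one.2 c8.2
    refine step ![x0 + 1, x1 + 1, x2, x3 + 1, x4 + 1, x5] ![a, b, c, d, e, f] ?_ ?_ ?_
    · simp [Fin.sum_univ_succ]; try omega
    · simp [Fin.sum_univ_succ]; omega
    · simp only [mon, Matrix.cons_val]
      linear_combination -(z 0 ^ x0 * z 1 ^ x1 * z 2 ^ x2 * z 3 ^ x3 * z 4 ^ x4 * z 5 ^ x5 * z 6 ^ a * z 7 ^ b * z 8 ^ c * z 9 ^ d * z 10 ^ e * z 11 ^ f) * r9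
  have hn := normal_case y (by omega) (by omega) (by omega) (by omega) (by omega) (by omega)
    (by omega) (by omega) (by omega)
  obtain ⟨u, hu1, hu2, hu3⟩ := hn
  refine ⟨(Finsupp.equivFunOnFinite.symm x, u), mem_In.2 ⟨?_, hu1⟩, ?_⟩
  · simp [hu3]
  · simp [g, hu2]

/-! ### Linear independence -/

abbrev L := AddMonoidAlgebra ℂ (Fin 8 → ℤ)

/-- Exponent vectors of the toric parametrization. -/
def vec : Fin 12 → (Fin 8 → ℤ) :=
  ![![1, 0, 0, 0, 0, 0, 0, 0], ![0, 1, 0, 0, 0, 0, 0, 0], ![0, 0, 1, 0, 0, 0, 0, 0],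
    ![0, 0, 0, 1, 0, 0, 0, 0], ![0, 0, 0, 0, 1, 0, 0, 0], ![0, 0, 0, 0, 0, 1, 0, 0],
    ![0, 0, 0, 0, 0, 0, 1, 0], ![0, 0, 0, 0, 0, 0, 0, 1], ![1, 1, 1, 1, 1, 1, -1, -1],
    ![-1, 0, 0, -1, 0, 0, 1, 1], ![1, 1, 0, 1, 1, 0, -1, 0], ![1, 0, 1, 1, 0, 1, 0, -1]]

noncomputable def tor (i : Fin 12) : L := AddMonoidAlgebra.single (vec i) 1

noncomputable def Psi0 : MvPolynomial (Fin 12) ℂ →ₐ[ℂ] L := aeval tor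

lemma Psi0_J : ∀ p ∈ J, Psi0 p = 0 := by
  intro p hp
  have : J ≤ RingHom.ker Psi0 := by
    unfold J
    rw [Ideal.span_le]
    intro q hq
    simp only [X₁₂, X₂₃, X₃₄, X₄₅, X₅₆, X₆₁, X₁₃, X₃₅, X₅₁, X₂₄, X₄₆, X₆₂,
      Set.mem_insert_iff, Set.mem_singleton_iff] at hq
    simp only [SetLike.mem_coe, RingHom.mem_ker]
    rcases hq with rfl | rfl | rfl | rfl | rfl | rfl | rfl | rfl | rfl <;>
    · simp only [Psi0, map_sub, map_mul, aeval_X, tor, AddMonoidAlgebra.single_mul_single, mul_one]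
      rw [sub_eq_zero]
      congr 1
      decide
  exact this hp

noncomputable def Psi : (MvPolynomial (Fin 12) ℂ ⧸ J) →ₐ[ℂ] L := Ideal.Quotient.liftₐ J Psi0 Psi0_J

lemma Psi_z (i : Fin 12) : Psi (z i) = tor i := by
  have : Psi (z i) = Psi0 (X i) := rfl
  rw [this, Psi0, aeval_X]

/-- Exponent vector of a monomial. -/
def phi (x y : Fin 6 → ℕ) : Fin 8 → ℤ :=
  ![x 0 - y 3 + y 4 + y 5 + y 2, x 1 + y 4 + y 2, x 2 + y 5 + y 2,
    x 3 - y 3 + y 4 + y 5 + y 2, x 4 + y 4 + y 2, x 5 + y 5 + y 2,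
    y 0 + y 3 - y 4 - y 2, y 1 + y 3 - y 5 - y 2]

lemma Psi_mon (x y : Fin 6 → ℕ) : Psi (mon z x y) = AddMonoidAlgebra.single (phi x y) 1 := by
  simp only [mon, map_mul, map_pow, Psi_z, tor, AddMonoidAlgebra.single_pow,
    AddMonoidAlgebra.single_mul_single, one_pow, mul_one]
  congr 1
  ext i
  fin_cases i <;> simp [vec, phi] <;> ring

lemma phi_inj {u v : Idx} (hu : u.2 = (0, 0, 0) ∨ u.2.2.2 < u.2.2.1)
    (hv : v.2 = (0, 0, 0) ∨ v.2.2.2 < v.2.2.1)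
    (huv : phi u.1 (yexp u.2) = phi v.1 (yexp v.2)) : u = v := by
  obtain ⟨x, i, k, q⟩ := u
  obtain ⟨x', i', k', q'⟩ := v
  simp only [Prod.mk.injEq] at hu hv
  have h0 := congrFun huv 0
  have h1 := congrFun huv 1
  have h2 := congrFun huv 2
  have h3 := congrFun huv 3
  have h4 := congrFun huv 4
  have h5 := congrFun huv 5
  have h6 := congrFun huv 6
  have h7 := congrFun huv 7
  clear huv
  simp only [phi, yexp, Matrix.cons_val] at h0 h1 h2 h3 h4 h5 h6 h7
  have hy : i = i' ∧ k = k' ∧ q = q' := by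
    clear h0 h1 h2 h3 h4 h5
    fin_cases i <;> fin_cases i' <;> simp [nfy] at * <;> omega
  obtain ⟨rfl, rfl, rfl⟩ := hy
  have hx : x = x' := by
    ext j
    fin_cases j <;> simp <;> omega
  rw [hx]

lemma li (n : ℕ) : LinearIndependent ℂ (fun u : In n => g u.1) := by
  apply LinearIndependent.of_comp Psi.toLinearMap
  have h1 : (Psi.toLinearMap ∘ fun u : In n => g u.1) =
      (fun v : Fin 8 → ℤ => (AddMonoidAlgebra.single v 1 : L)) ∘
        (fun u : In n => phi u.1.1 (yexp u.1.2)) := by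
    ext1 u
    simp only [Function.comp, AlgHom.toLinearMap_apply, g, Psi_mon]
  rw [h1]
  refine LinearIndependent.comp ?_ _ ?_
  · refine LinearIndependent.of_comp (AddMonoidAlgebra.coeffLinearEquiv ℂ).toLinearMap ?_
    exact Finsupp.linearIndependent_single_one ℂ (Fin 8 → ℤ)
  · rintro ⟨u, hu⟩ ⟨v, hv⟩ huv
    exact Subtype.ext (phi_inj (mem_In.1 hu).2 (mem_In.1 hv).2 huv)

/-! ### The graded pieces -/

lemma mk_monomial (d : Fin 12 →₀ ℕ) : Ideal.Quotient.mkₐ ℂ J (monomial d 1) =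
    mon z ![d 0, d 1, d 2, d 3, d 4, d 5] ![d 6, d 7, d 8, d 9, d 10, d 11] := by
  rw [monomial_eq, Finsupp.prod_fintype _ _ (by simp)]
  simp [Fin.prod_univ_succ, mon, z]
  ring

lemma weight_eq (d : Fin 12 →₀ ℕ) : Finsupp.weight w d =
    ∑ i, ![d 0, d 1, d 2, d 3, d 4, d 5] i + 2 * ∑ i, ![d 6, d 7, d 8, d 9, d 10, d 11] i := by
  rw [Finsupp.weight_apply, Finsupp.sum_fintype _ _ (by simp)]
  simp [Fin.sum_univ_succ, w]
  ring

lemma piece (n : ℕ) :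
    (weightedHomogeneousSubmodule ℂ w n).map (Ideal.Quotient.mkₐ ℂ J).toLinearMap =
      Submodule.span ℂ (Set.range fun u : In n => g u.1) := by
  apply le_antisymm
  · rw [Submodule.map_le_iff_le_comap]
    intro p hp
    rw [Submodule.mem_comap, p.as_sum, map_sum]
    refine Submodule.sum_mem _ fun d hd => ?_
    have hw : Finsupp.weight w d = n := hp (mem_support_iff.1 hd)
    have h1 : monomial d (coeff d p) = coeff d p • monomial d (1 : ℂ) := by
      rw [smul_monomial, smul_eq_mul, mul_one]
    rw [h1, map_smul]
    refine Submodule.smul_mem _ _ (Submodule.subset_span ?_)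
    obtain ⟨u, hu, he⟩ := reduce _ ![d 0, d 1, d 2, d 3, d 4, d 5]
      ![d 6, d 7, d 8, d 9, d 10, d 11] rfl
    rw [← weight_eq, hw] at hu
    exact ⟨⟨u, hu⟩, by rw [AlgHom.toLinearMap_apply, mk_monomial, he]⟩
  · rw [Submodule.span_le]
    rintro _ ⟨⟨⟨x, y⟩, hu⟩, rfl⟩
    obtain ⟨hn, hy⟩ := mem_In.1 hu
    let d : Fin 12 →₀ ℕ := Finsupp.equivFunOnFinite.symm
      ![x 0, x 1, x 2, x 3, x 4, x 5, yexp y 0, yexp y 1, yexp y 2, yexp y 3, yexp y 4, yexp y 5]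
    refine ⟨monomial d 1, ?_, ?_⟩
    · refine isWeightedHomogeneous_monomial _ _ _ ?_
      rw [weight_eq, ← hn]
      have hs : ∑ i, yexp y i = y.2.1 := by
        obtain ⟨i, k, q⟩ := y
        simp only [Prod.mk.injEq] at hy
        fin_cases i <;> simp [yexp, nfy, Fin.sum_univ_succ] at * <;> omega
      rw [← hs]
      simp [d, Fin.sum_univ_succ]
    · rw [AlgHom.toLinearMap_apply, mk_monomial]
      simp [d, g, mon]

lemma h_eq (n : ℕ) : h n = (In n).card := by
  unfold h
  rw [piece, finrank_span_eq_card (li n), Fintype.card_coe]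

/-- The Hilbert series of the coherent component of the `dP₃`
master space satisfies `H(t)·(1−t)⁶(1−t²)⁶ = 1 − 9t⁴ + 16t⁶ − 9t⁸ + t¹²`, i.e.
`H(t; F_irr(dP₃)) = (1 + 4t² + t⁴)/((1−t)⁸(1+t)²)`; the numerator is palindromic,
reflecting that the coherent component is Calabi–Yau of dimension 8. -/
theorem hilbert_series_dP3_coherent :
    (PowerSeries.mk fun n => (h n : ℤ))
        * (1 - PowerSeries.X) ^ 6 * (1 - PowerSeries.X ^ 2) ^ 6
      = 1 - 9 * PowerSeries.X ^ 4 + 16 * PowerSeries.X ^ 6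
        - 9 * PowerSeries.X ^ 8 + PowerSeries.X ^ 12 := by
  simp only [h_eq]
  exact series_In

end DP3CoherentHilbert
end

section
/- Let R be the polynomial ring over ℂ in the 16 variables X₁₃, X₃₅, X₅₈, X₈₁, X₁₄, X₄₆, X₆₈, X₅₇, X₇₂, X₂₃, X₆₇, X₂₄, X₇₁, X₃₆, X₄₅, X₈₂ with the standard grading, let W = −X₁₃X₃₅X₅₈X₈₁ + X₁₄X₄₆X₆₈X₈₁ + X₃₅X₅₇X₇₂X₂₃ − X₄₆X₆₇X₇₂X₂₄ + X₆₇X₇₁X₁₃X₃₆ − X₅₇X₇₁X₁₄X₄₅ + X₅₈X₈₂X₂₄X₄₅ − X₆₈X₈₂X₂₃X₃₆ be the superpotential of the PdP₅ quiver gauge theory, and let I ⊆ R be the ideal generated by the 16 partial derivatives of W. Then the Hilbert series of R/I satisfies (Σ_{n≥0} h(n) tⁿ)·(1−t)¹⁰ = 1 + 6t + 21t² + 40t³ + 39t⁴ − 30t⁵ + 19t⁶; i.e. H(t; F♭_{PdP₅}) = (1 + 6t + 21t² + 40t³ + 39t⁴ − 30t⁵ + 19t⁶)/(1−t)¹⁰.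 In particular the master space of PdP₅ has dimension 10. -/
open MvPolynomial

namespace PdP5Hilbert

-- R = ℂ[X₁₃, X₃₅, X₅₈, X₈₁, X₁₄, X₄₆, X₆₈, X₅₇, X₇₂, X₂₃, X₆₇, X₂₄, X₇₁, X₃₆, X₄₅, X₈₂],
-- standard grading (all weights 1)
noncomputable def X₁₃ : MvPolynomial (Fin 16) ℂ := X 0
noncomputable def X₃₅ : MvPolynomial (Fin 16) ℂ := X 1
noncomputable def X₅₈ : MvPolynomial (Fin 16) ℂ := X 2
noncomputable def X₈₁ : MvPolynomial (Fin 16) ℂ := X 3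
noncomputable def X₁₄ : MvPolynomial (Fin 16) ℂ := X 4
noncomputable def X₄₆ : MvPolynomial (Fin 16) ℂ := X 5
noncomputable def X₆₈ : MvPolynomial (Fin 16) ℂ := X 6
noncomputable def X₅₇ : MvPolynomial (Fin 16) ℂ := X 7
noncomputable def X₇₂ : MvPolynomial (Fin 16) ℂ := X 8
noncomputable def X₂₃ : MvPolynomial (Fin 16) ℂ := X 9
noncomputable def X₆₇ : MvPolynomial (Fin 16) ℂ := X 10
noncomputable def X₂₄ : MvPolynomial (Fin 16) ℂ := X 11
noncomputable def X₇₁ : MvPolynomial (Fin 16) ℂ := X 12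
noncomputable def X₃₆ : MvPolynomial (Fin 16) ℂ := X 13
noncomputable def X₄₅ : MvPolynomial (Fin 16) ℂ := X 14
noncomputable def X₈₂ : MvPolynomial (Fin 16) ℂ := X 15

/-- The superpotential of the `PdP₅` quiver gauge theory. -/
noncomputable def W : MvPolynomial (Fin 16) ℂ :=
  -(X₁₃ * X₃₅ * X₅₈ * X₈₁) + X₁₄ * X₄₆ * X₆₈ * X₈₁
    + X₃₅ * X₅₇ * X₇₂ * X₂₃ - X₄₆ * X₆₇ * X₇₂ * X₂₄
    + X₆₇ * X₇₁ * X₁₃ * X₃₆ - X₅₇ * X₇₁ * X₁₄ * X₄₅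
    + X₅₈ * X₈₂ * X₂₄ * X₄₅ - X₆₈ * X₈₂ * X₂₃ * X₃₆

/-- The ideal generated by the 16 partial derivatives of `W`. -/
noncomputable def I : Ideal (MvPolynomial (Fin 16) ℂ) :=
  Ideal.span (Set.range fun v => pderiv v W)

/-- The Hilbert function of `R/I` with the standard grading:
`h(n) = dim_ℂ R_n/(I ∩ R_n)`. -/
noncomputable def h (n : ℕ) : ℕ :=
  Module.finrank ℂ
    ((homogeneousSubmodule (Fin 16) ℂ n).map (Ideal.Quotient.mkₐ ℂ I).toLinearMap)

/-! ### Computations with exponent vectors, stored as lists -/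

/-- Pointwise sum. -/
def ladd : List ℕ → List ℕ → List ℕ
  | [], b => b
  | x :: a, [] => x :: a
  | x :: a, y :: b => (x + y) :: ladd a b

/-- Pointwise truncated difference. -/
def lsub : List ℕ → List ℕ → List ℕ
  | [], _ => []
  | x :: a, [] => x :: a
  | x :: a, y :: b => (x - y) :: lsub a b

/-- Pointwise maximum (least common multiple of monomials). -/
def lmax : List ℕ → List ℕ → List ℕ
  | [], b => b
  | x :: a, [] => x :: a
  | x :: a, y :: b => (x + (y - x)) :: lmax a b

/-- Pointwise comparison (divisibility of monomials). -/
def lle : List ℕ → List ℕ → Bool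
  | [], _ => true
  | x :: a, [] => Nat.beq x 0 && lle a []
  | x :: a, y :: b => Nat.ble x y && lle a b

def leq : List ℕ → List ℕ → Bool
  | [], [] => true
  | [], _ :: _ => false
  | _ :: _, [] => false
  | x :: a, y :: b => Nat.beq x y && leq a b

/-- Rewriting by the rules with the listed indices. -/
def reds (R : List (List ℕ × List ℕ)) : List ℕ → List ℕ → List ℕ
  | [], a => a
  | k :: ks, a => match R[k]? with
    | none => a
    | some p => bif lle p.1 a then reds R ks (ladd (lsub a p.1) p.2) else a

/-- The S-pair of `p` and `q` is joined by the given rewritings. -/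
def spair (R : List (List ℕ × List ℕ)) (p q : List ℕ × List ℕ) (c : List ℕ × List ℕ) : Bool :=
  leq (reds R c.1 (ladd (lsub (lmax p.1 q.1) p.1) p.2))
    (reds R c.2 (ladd (lsub (lmax p.1 q.1) q.1) q.2))

def sprow (R : List (List ℕ × List ℕ)) (p : List ℕ × List ℕ) :
    List (List ℕ × List ℕ) → List (List ℕ × List ℕ) → Bool
  | [], _ => true
  | _ :: _, [] => false
  | q :: S, c :: cs => spair R p q c && sprow R p S cs

def spairs (R : List (List ℕ × List ℕ)) :
    List (List ℕ × List ℕ) → List (List (List ℕ × List ℕ)) → Bool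
  | [], _ => true
  | _ :: _, [] => false
  | p :: S, c :: cs => sprow R p S c && spairs R S cs

/-- Follow a path of moves along the generators. -/
def walk (G : List (List ℕ × List ℕ)) : List ℕ → List ℕ → Option (List ℕ)
  | [], a => some a
  | k :: ks, a =>
    match G[k / 2]? with
    | none => none
    | some p =>
      bif Nat.beq (k % 2) 0 then
        bif lle p.1 a then walk G ks (ladd (lsub a p.1) p.2) else none
      else
        bif lle p.2 a then walk G ks (ladd (lsub a p.2) p.1) else none

def walkOk (G : List (List ℕ × List ℕ)) (p : List ℕ × List ℕ) (ks : List ℕ) : Bool :=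
  match walk G ks p.1 with
  | none => false
  | some b => leq b p.2

def walksOk (G : List (List ℕ × List ℕ)) : List (List ℕ × List ℕ) → List (List ℕ) → Bool
  | [], _ => true
  | _ :: _, [] => false
  | p :: R, k :: ks => walkOk G p k && walksOk G R ks

/-- Drop the constraints involving the first variable, take tails of the others. -/
def dropHd : List (List ℕ) → List (List ℕ)
  | [] => []
  | c :: C => bif Nat.beq (c.headD 0) 0 then c.tail :: dropHd C else dropHd C

def lzero : List ℕ → Bool
  | [] => true
  | x :: a => Nat.beq x 0 && lzero a

/-- The binomial coefficients. -/
def binom : ℕ → List ℕ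
  | 0 => [1]
  | n + 1 => ladd (binom n) (0 :: binom n)

/-- Face polynomial of the simplicial complex on `n` vertices with non-faces `C`. -/
def faces : ℕ → List (List ℕ) → List ℕ
  | 0, C => bif C.isEmpty then [1] else []
  | n + 1, C => bif C.isEmpty then binom (n + 1) else bif C.any lzero then [] else
      ladd (faces n (dropHd C)) (0 :: faces n (C.map List.tail))

def gens : List (List ℕ × List ℕ) := [
  ([0,1,1,1,0,0,0,0,0,0,0,0,0,0,0,0], [0,0,0,0,0,0,0,0,0,0,1,0,1,1,0,0]),
  ([1,0,1,1,0,0,0,0,0,0,0,0,0,0,0,0], [0,0,0,0,0,0,0,1,1,1,0,0,0,0,0,0]),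
  ([1,1,0,1,0,0,0,0,0,0,0,0,0,0,0,0], [0,0,0,0,0,0,0,0,0,0,0,1,0,0,1,1]),
  ([1,1,1,0,0,0,0,0,0,0,0,0,0,0,0,0], [0,0,0,0,1,1,1,0,0,0,0,0,0,0,0,0]),
  ([0,0,0,1,0,1,1,0,0,0,0,0,0,0,0,0], [0,0,0,0,0,0,0,1,0,0,0,0,1,0,1,0]),
  ([0,0,0,1,1,0,1,0,0,0,0,0,0,0,0,0], [0,0,0,0,0,0,0,0,1,0,1,1,0,0,0,0]),
  ([0,0,0,1,1,1,0,0,0,0,0,0,0,0,0,0], [0,0,0,0,0,0,0,0,0,1,0,0,0,1,0,1]),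
  ([0,1,0,0,0,0,0,0,1,1,0,0,0,0,0,0], [0,0,0,0,1,0,0,0,0,0,0,0,1,0,1,0]),
  ([0,1,0,0,0,0,0,1,0,1,0,0,0,0,0,0], [0,0,0,0,0,1,0,0,0,0,1,1,0,0,0,0]),
  ([0,1,0,0,0,0,0,1,1,0,0,0,0,0,0,0], [0,0,0,0,0,0,1,0,0,0,0,0,0,1,0,1]),
  ([0,0,0,0,0,1,0,0,1,0,0,1,0,0,0,0], [1,0,0,0,0,0,0,0,0,0,0,0,1,1,0,0]),
  ([0,0,0,0,0,1,0,0,1,0,1,0,0,0,0,0], [0,0,1,0,0,0,0,0,0,0,0,0,0,0,1,1]),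
  ([1,0,0,0,0,0,0,0,0,0,1,0,0,1,0,0], [0,0,0,0,1,0,0,1,0,0,0,0,0,0,1,0]),
  ([1,0,0,0,0,0,0,0,0,0,1,0,1,0,0,0], [0,0,0,0,0,0,1,0,0,1,0,0,0,0,0,1]),
  ([0,0,0,0,1,0,0,1,0,0,0,0,1,0,0,0], [0,0,1,0,0,0,0,0,0,0,0,1,0,0,0,1]),
  ([0,0,1,0,0,0,0,0,0,0,0,1,0,0,1,0], [0,0,0,0,0,0,1,0,0,1,0,0,0,1,0,0])]

def rules : List (List ℕ × List ℕ) := [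
  ([0,0,0,0,0,0,0,0,0,0,0,1,0,0,1,1], [1,1,0,1,0,0,0,0,0,0,0,0,0,0,0,0]),
  ([0,0,0,0,0,0,0,0,0,0,1,0,1,1,0,0], [0,1,1,1,0,0,0,0,0,0,0,0,0,0,0,0]),
  ([0,0,0,0,0,0,1,0,0,0,0,0,0,1,0,1], [0,1,0,0,0,0,0,1,1,0,0,0,0,0,0,0]),
  ([0,0,0,0,0,1,0,0,0,0,1,1,0,0,0,0], [0,1,0,0,0,0,0,1,0,1,0,0,0,0,0,0]),
  ([0,0,0,0,1,0,0,0,0,0,0,0,1,0,1,0], [0,1,0,0,0,0,0,0,1,1,0,0,0,0,0,0]),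
  ([0,0,0,0,1,1,1,0,0,0,0,0,0,0,0,0], [1,1,1,0,0,0,0,0,0,0,0,0,0,0,0,0]),
  ([0,0,0,1,0,1,1,0,0,0,0,0,0,0,0,0], [0,0,0,0,0,0,0,1,0,0,0,0,1,0,1,0]),
  ([0,0,0,1,1,0,1,0,0,0,0,0,0,0,0,0], [0,0,0,0,0,0,0,0,1,0,1,1,0,0,0,0]),
  ([0,0,0,1,1,1,0,0,0,0,0,0,0,0,0,0], [0,0,0,0,0,0,0,0,0,1,0,0,0,1,0,1]),
  ([0,0,1,0,0,0,0,0,0,0,0,0,0,0,1,1], [0,0,0,0,0,1,0,0,1,0,1,0,0,0,0,0]),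
  ([0,0,1,0,0,0,0,0,0,0,0,1,0,0,0,1], [0,0,0,0,1,0,0,1,0,0,0,0,1,0,0,0]),
  ([0,0,1,0,0,0,0,0,0,0,0,1,0,0,1,0], [0,0,0,0,0,0,1,0,0,1,0,0,0,1,0,0]),
  ([1,0,0,0,0,0,0,0,0,0,0,0,1,1,0,0], [0,0,0,0,0,1,0,0,1,0,0,1,0,0,0,0]),
  ([1,0,0,0,0,0,0,0,0,0,1,0,0,1,0,0], [0,0,0,0,1,0,0,1,0,0,0,0,0,0,1,0]),
  ([1,0,0,0,0,0,0,0,0,0,1,0,1,0,0,0], [0,0,0,0,0,0,1,0,0,1,0,0,0,0,0,1]),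
  ([1,0,1,1,0,0,0,0,0,0,0,0,0,0,0,0], [0,0,0,0,0,0,0,1,1,1,0,0,0,0,0,0]),
  ([0,0,0,0,0,0,0,0,0,1,0,0,1,1,1,1], [0,1,0,1,0,1,0,0,1,1,0,0,0,0,0,0]),
  ([0,0,0,0,0,0,0,0,0,1,1,1,0,1,0,1], [0,1,0,1,1,0,0,1,0,1,0,0,0,0,0,0]),
  ([0,0,0,0,0,0,0,0,1,0,1,1,0,1,0,1], [0,1,0,1,1,0,0,1,1,0,0,0,0,0,0,0]),
  ([0,0,0,0,0,0,0,0,1,0,1,1,1,0,1,0], [0,1,0,1,0,0,1,0,1,1,0,0,0,0,0,0]),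
  ([0,0,0,0,0,0,0,1,0,0,0,0,1,1,1,1], [0,1,0,1,0,1,0,1,1,0,0,0,0,0,0,0]),
  ([0,0,0,0,0,0,0,1,0,0,1,1,1,0,1,0], [0,1,0,1,0,0,1,1,0,1,0,0,0,0,0,0]),
  ([0,0,0,0,0,1,1,0,0,1,0,1,0,0,0,1], [1,1,0,0,0,0,0,1,0,1,0,0,1,0,0,0]),
  ([0,0,0,0,0,1,1,0,0,1,1,0,0,1,0,0], [0,1,1,0,0,0,0,1,0,1,0,0,0,0,1,0]),
  ([0,0,0,0,0,1,1,0,1,0,0,1,0,0,0,1], [1,1,0,0,0,0,0,1,1,0,0,0,1,0,0,0]),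
  ([0,0,0,0,0,1,1,0,1,0,1,0,0,1,0,0], [0,1,1,0,0,0,0,1,1,0,0,0,0,0,1,0]),
  ([0,0,0,0,1,0,1,0,0,1,0,0,0,0,1,1], [1,1,0,0,0,0,0,0,1,1,1,0,0,0,0,0]),
  ([0,0,0,0,1,0,1,0,0,1,0,0,1,1,0,0], [0,1,1,0,0,0,0,0,1,1,0,1,0,0,0,0]),
  ([0,0,0,0,1,0,1,1,0,0,0,0,0,0,1,1], [1,1,0,0,0,0,0,1,1,0,1,0,0,0,0,0]),
  ([0,0,0,0,1,0,1,1,0,0,0,0,1,1,0,0], [0,1,1,0,0,0,0,1,1,0,0,1,0,0,0,0]),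
  ([0,0,0,0,1,1,0,0,1,0,0,1,0,0,1,0], [1,1,0,0,0,0,0,0,1,1,0,0,0,1,0,0]),
  ([0,0,0,0,1,1,0,0,1,0,1,0,1,0,0,0], [0,1,1,0,0,0,0,0,1,1,0,0,0,0,0,1]),
  ([0,0,0,0,1,1,0,1,0,0,0,1,0,0,1,0], [1,1,0,0,0,0,0,1,0,1,0,0,0,1,0,0]),
  ([0,0,0,0,1,1,0,1,0,0,1,0,1,0,0,0], [0,1,1,0,0,0,0,1,0,1,0,0,0,0,0,1]),
  ([0,0,1,1,0,0,1,0,0,1,0,0,0,0,0,1], [0,0,0,0,0,0,0,1,1,1,1,0,1,0,0,0]),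
  ([0,0,1,1,0,1,0,0,1,0,0,1,0,0,0,0], [0,0,0,0,0,0,0,1,1,1,0,0,1,1,0,0]),
  ([0,0,1,1,1,0,0,1,0,0,0,0,0,0,1,0], [0,0,0,0,0,0,0,1,1,1,1,0,0,1,0,0]),
  ([0,1,1,1,0,0,1,0,0,0,0,0,0,0,0,1], [0,1,0,0,0,0,0,1,1,0,1,0,1,0,0,0]),
  ([0,1,1,1,0,1,0,0,0,0,0,1,0,0,0,0], [0,1,0,0,0,0,0,1,0,1,0,0,1,1,0,0]),
  ([0,1,1,1,1,0,0,0,0,0,0,0,0,0,1,0], [0,1,0,0,0,0,0,0,1,1,1,0,0,1,0,0]),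
  ([1,0,0,1,0,0,1,0,0,1,0,0,0,1,0,0], [0,0,0,0,0,0,0,1,1,1,0,1,0,0,1,0]),
  ([1,0,0,1,0,1,0,0,1,0,1,0,0,0,0,0], [0,0,0,0,0,0,0,1,1,1,0,0,0,0,1,1]),
  ([1,0,0,1,1,0,0,1,0,0,0,0,1,0,0,0], [0,0,0,0,0,0,0,1,1,1,0,1,0,0,0,1]),
  ([1,0,1,0,0,0,0,0,0,1,0,0,0,1,0,1], [0,0,0,0,1,1,0,1,1,1,0,0,0,0,0,0]),
  ([1,0,1,0,0,0,0,0,1,0,1,1,0,0,0,0], [0,0,0,0,1,0,1,1,1,1,0,0,0,0,0,0]),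
  ([1,0,1,0,0,0,0,1,0,0,0,0,1,0,1,0], [0,0,0,0,0,1,1,1,1,1,0,0,0,0,0,0]),
  ([1,1,0,1,0,0,1,0,0,0,0,0,0,1,0,0], [0,1,0,0,0,0,0,1,1,0,0,1,0,0,1,0]),
  ([1,1,0,1,0,1,0,0,0,0,1,0,0,0,0,0], [0,1,0,0,0,0,0,1,0,1,0,0,0,0,1,1]),
  ([1,1,0,1,1,0,0,0,0,0,0,0,1,0,0,0], [0,1,0,0,0,0,0,0,1,1,0,1,0,0,0,1]),
  ([1,1,1,0,0,0,0,0,0,0,0,0,0,1,0,1], [0,1,0,0,1,1,0,1,1,0,0,0,0,0,0,0]),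
  ([1,1,1,0,0,0,0,0,0,0,0,0,1,0,1,0], [0,1,0,0,0,1,1,0,1,1,0,0,0,0,0,0]),
  ([1,1,1,0,0,0,0,0,0,0,1,1,0,0,0,0], [0,1,0,0,1,0,1,1,0,1,0,0,0,0,0,0])]

def paths : List (List ℕ) := [
  [5],
  [1],
  [19],
  [17],
  [15],
  [7],
  [8],
  [10],
  [12],
  [23],
  [29],
  [30],
  [21],
  [24],
  [26],
  [2],
  [13,15],
  [13,17],
  [11,19],
  [11,15],
  [9,19],
  [9,17],
  [27,17],
  [31,17],
  [20,19],
  [22,19],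
  [27,15],
  [31,15],
  [25,19],
  [28,19],
  [20,15],
  [22,15],
  [25,17],
  [28,17],
  [27,2],
  [20,2],
  [25,2],
  [0,19],
  [0,17],
  [0,15],
  [31,2],
  [22,2],
  [28,2],
  [13,2],
  [11,2],
  [9,2],
  [4,19],
  [4,17],
  [4,15],
  [6,19],
  [6,15],
  [6,17]]

def wt : List ℕ := [65520,32768,63488,65535,65408,65528,64512,61440,49152,57344,65532,65504,65280,65472,65024,65534]

def certs : List (List (List ℕ × List ℕ)) := [
  [([1],[0]), ([46],[]), ([47],[]), ([48],[]), ([5],[0]), ([6],[0]), ([7],[0]), ([8],[0]),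
    ([15],[3]), ([15],[4]), ([15],[2]), ([12],[0]), ([13],[0]), ([14],[0]), ([15],[0]), ([12],[]),
    ([13],[]), ([13],[]), ([14],[]), ([12],[]), ([14],[]), ([6],[]), ([23],[0]), ([6],[]),
    ([25],[0]), ([7],[]), ([27],[0]), ([7],[]), ([29],[0]), ([8],[]), ([31],[0]), ([8],[]),
    ([33],[0]), ([15],[19]), ([15],[16]), ([15],[17]), ([15],[19]), ([15],[16]), ([15],[17]),
    ([40],[0]), ([41],[0]), ([42],[0]), ([15],[30]), ([15],[26]), ([15],[22]), ([46],[0]),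
    ([47],[0]), ([48],[0]), ([15],[30]), ([15],[22]), ([15],[26])],
  [([37],[]), ([38],[]), ([39],[]), ([5],[1]), ([6],[1]), ([7],[1]), ([8],[1]), ([9],[1]),
    ([10],[1]), ([11],[1]), ([15],[3]), ([15],[4]), ([15],[2]), ([15],[1]), ([9],[]), ([10],[]),
    ([10],[]), ([11],[]), ([9],[]), ([11],[]), ([22],[1]), ([6],[]), ([24],[1]), ([6],[]),
    ([26],[1]), ([7],[]), ([28],[1]), ([7],[]), ([30],[1]), ([8],[]), ([32],[1]), ([8],[]),
    ([34],[1]), ([35],[1]), ([36],[1]), ([37],[1]), ([38],[1]), ([39],[1]), ([15],[19]),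
    ([15],[16]), ([15],[17]), ([15],[31]), ([15],[27]), ([15],[23]), ([15],[19]), ([15],[16]),
    ([15],[17]), ([15],[31]), ([15],[23]), ([15],[27])],
  [([3],[2]), ([4],[2]), ([],[49]), ([],[20]), ([],[18]), ([8],[2]), ([],[25]), ([],[29]),
    ([11],[2]), ([],[24]), ([],[28]), ([14],[2]), ([15],[2]), ([],[6]), ([],[7]), ([],[7]),
    ([19],[2]), ([],[6]), ([19],[2]), ([],[12]), ([],[9]), ([],[12]), ([],[9]), ([],[13]),
    ([],[10]), ([],[13]), ([],[10]), ([30],[2]), ([31],[2]), ([30],[2]), ([31],[2]), ([],[1]),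
    ([35],[2]), ([36],[2]), ([],[1]), ([35],[2]), ([36],[2]), ([],[0]), ([41],[2]), ([42],[2]),
    ([],[5]), ([44],[2]), ([45],[2]), ([],[0]), ([41],[2]), ([42],[2]), ([],[5]), ([45],[2]),
    ([44],[2])],
  [([4],[3]), ([],[51]), ([],[21]), ([7],[3]), ([],[17]), ([9],[3]), ([],[33]), ([],[23]),
    ([12],[3]), ([],[32]), ([],[22]), ([15],[3]), ([16],[3]), ([],[8]), ([],[8]), ([],[6]),
    ([16],[3]), ([],[6]), ([],[14]), ([],[11]), ([],[14]), ([],[11]), ([26],[3]), ([27],[3]),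
    ([26],[3]), ([27],[3]), ([],[13]), ([],[10]), ([],[13]), ([],[10]), ([34],[3]), ([],[1]),
    ([36],[3]), ([34],[3]), ([],[1]), ([36],[3]), ([40],[3]), ([],[0]), ([42],[3]), ([43],[3]),
    ([],[5]), ([45],[3]), ([40],[3]), ([],[0]), ([42],[3]), ([43],[3]), ([45],[3]), ([],[5])],
  [([],[50]), ([6],[4]), ([],[19]), ([],[16]), ([],[31]), ([10],[4]), ([],[27]), ([],[30]),
    ([13],[4]), ([],[26]), ([15],[4]), ([],[8]), ([17],[4]), ([17],[4]), ([],[7]), ([],[8]),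
    ([],[7]), ([22],[4]), ([23],[4]), ([22],[4]), ([23],[4]), ([],[14]), ([],[11]), ([],[14]),
    ([],[11]), ([],[12]), ([],[9]), ([],[12]), ([],[9]), ([34],[4]), ([35],[4]), ([],[1]),
    ([34],[4]), ([35],[4]), ([],[1]), ([40],[4]), ([41],[4]), ([],[0]), ([43],[4]), ([44],[4]),
    ([],[5]), ([40],[4]), ([41],[4]), ([],[0]), ([43],[4]), ([],[5]), ([44],[4])],
  [([15],[4]), ([15],[3]), ([15],[2]), ([9],[5]), ([10],[5]), ([11],[5]), ([12],[5]), ([13],[5]),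
    ([14],[5]), ([15],[5]), ([16],[5]), ([17],[5]), ([18],[5]), ([19],[5]), ([20],[5]),
    ([21],[5]), ([10],[]), ([13],[]), ([10],[]), ([13],[]), ([9],[]), ([12],[]), ([9],[]),
    ([12],[]), ([11],[]), ([14],[]), ([11],[]), ([14],[]), ([15],[31]), ([15],[27]), ([15],[23]),
    ([15],[31]), ([15],[27]), ([15],[23]), ([15],[30]), ([15],[26]), ([15],[22]), ([43],[5]),
    ([44],[5]), ([45],[5]), ([15],[30]), ([15],[26]), ([15],[22]), ([49],[5]), ([50],[5]),
    ([51],[5])],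
  [([4],[3]), ([4],[2]), ([9],[6]), ([0],[5]), ([11],[6]), ([12],[6]), ([1],[5]), ([14],[6]),
    ([45],[]), ([16],[6]), ([16],[7]), ([18],[6]), ([19],[6]), ([20],[6]), ([21],[6]), ([0],[]),
    ([1],[]), ([0],[]), ([1],[]), ([4],[41]), ([4],[35]), ([4],[41]), ([4],[35]), ([4],[40]),
    ([4],[34]), ([4],[40]), ([4],[34]), ([9],[]), ([11],[]), ([4],[23]), ([9],[]), ([11],[]),
    ([4],[23]), ([12],[]), ([14],[]), ([4],[22]), ([16],[5]), ([19],[5]), ([45],[6]), ([12],[]),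
    ([14],[]), ([4],[22]), ([20],[5]), ([45],[6]), ([21],[5])],
  [([3],[2]), ([0],[5]), ([10],[7]), ([11],[7]), ([1],[5]), ([13],[7]), ([14],[7]), ([44],[]),
    ([16],[7]), ([17],[7]), ([18],[7]), ([19],[7]), ([18],[6]), ([19],[7]), ([3],[42]),
    ([3],[36]), ([3],[42]), ([3],[36]), ([0],[]), ([1],[]), ([0],[]), ([1],[]), ([3],[40]),
    ([3],[34]), ([3],[40]), ([3],[34]), ([10],[]), ([3],[27]), ([11],[]), ([10],[]), ([3],[27]),
    ([11],[]), ([13],[]), ([3],[26]), ([14],[]), ([17],[5]), ([44],[7]), ([19],[5]), ([13],[]),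
    ([3],[26]), ([14],[]), ([18],[5]), ([19],[5]), ([44],[7])],
  [([9],[8]), ([10],[8]), ([0],[5]), ([12],[8]), ([13],[8]), ([1],[5]), ([43],[]), ([16],[8]),
    ([17],[8]), ([17],[8]), ([16],[7]), ([16],[8]), ([16],[7]), ([2],[42]), ([2],[36]),
    ([2],[42]), ([2],[36]), ([2],[41]), ([2],[35]), ([2],[41]), ([2],[35]), ([0],[]), ([1],[]),
    ([0],[]), ([1],[]), ([2],[31]), ([10],[]), ([9],[]), ([2],[31]), ([10],[]), ([9],[]),
    ([2],[30]), ([13],[]), ([12],[]), ([43],[8]), ([17],[5]), ([16],[5]), ([2],[30]), ([13],[]),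
    ([12],[]), ([43],[8]), ([16],[5]), ([17],[5])],
  [([3],[4]), ([3],[2]), ([1],[0]), ([13],[9]), ([14],[9]), ([41],[]), ([1],[]), ([3],[36]),
    ([3],[36]), ([3],[34]), ([1],[]), ([3],[34]), ([3],[45]), ([23],[9]), ([3],[45]), ([25],[9]),
    ([5],[]), ([23],[10]), ([5],[]), ([25],[10]), ([3],[43]), ([31],[9]), ([3],[43]), ([31],[9]),
    ([6],[]), ([3],[16]), ([8],[]), ([6],[]), ([3],[16]), ([8],[]), ([23],[0]), ([41],[9]),
    ([31],[0]), ([13],[]), ([3],[26]), ([14],[]), ([25],[0]), ([41],[9]), ([31],[0]), ([13],[]),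
    ([14],[]), ([3],[26])],
  [([4],[2]), ([12],[10]), ([1],[0]), ([14],[10]), ([42],[]), ([4],[35]), ([1],[]), ([1],[]),
    ([4],[34]), ([4],[35]), ([4],[34]), ([5],[]), ([23],[10]), ([5],[]), ([25],[10]), ([4],[44]),
    ([27],[10]), ([4],[44]), ([29],[10]), ([4],[43]), ([31],[10]), ([4],[43]), ([33],[10]),
    ([7],[]), ([8],[]), ([4],[17]), ([7],[]), ([8],[]), ([4],[17]), ([27],[0]), ([31],[0]),
    ([42],[10]), ([12],[]), ([14],[]), ([4],[22]), ([29],[0]), ([33],[0]), ([42],[10]), ([12],[]),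
    ([4],[22]), ([14],[])],
  [([12],[11]), ([13],[11]), ([1],[0]), ([40],[]), ([2],[35]), ([2],[36]), ([2],[36]), ([1],[]),
    ([2],[35]), ([1],[]), ([2],[45]), ([23],[11]), ([2],[45]), ([23],[11]), ([2],[44]),
    ([27],[11]), ([2],[44]), ([27],[11]), ([5],[]), ([23],[10]), ([5],[]), ([23],[10]),
    ([2],[19]), ([6],[]), ([7],[]), ([2],[19]), ([6],[]), ([7],[]), ([40],[11]), ([23],[0]),
    ([27],[0]), ([2],[30]), ([13],[]), ([12],[]), ([40],[11]), ([23],[0]), ([27],[0]), ([2],[30]),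
    ([12],[]), ([13],[])],
  [([3],[4]), ([3],[2]), ([35],[]), ([0],[]), ([3],[42]), ([3],[42]), ([3],[40]), ([0],[]),
    ([3],[40]), ([22],[12]), ([3],[45]), ([24],[12]), ([3],[45]), ([22],[13]), ([5],[]),
    ([24],[13]), ([5],[]), ([30],[12]), ([3],[43]), ([30],[12]), ([3],[43]), ([22],[1]),
    ([35],[12]), ([30],[1]), ([24],[1]), ([35],[12]), ([30],[1]), ([6],[]), ([3],[16]), ([8],[]),
    ([10],[]), ([3],[27]), ([11],[]), ([6],[]), ([3],[16]), ([8],[]), ([10],[]), ([11],[]),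
    ([3],[27])],
  [([4],[2]), ([36],[]), ([4],[41]), ([0],[]), ([0],[]), ([4],[40]), ([4],[41]), ([4],[40]),
    ([22],[13]), ([5],[]), ([24],[13]), ([5],[]), ([26],[13]), ([4],[44]), ([28],[13]),
    ([4],[44]), ([30],[13]), ([4],[43]), ([32],[13]), ([4],[43]), ([26],[1]), ([30],[1]),
    ([36],[13]), ([28],[1]), ([32],[1]), ([36],[13]), ([7],[]), ([8],[]), ([4],[17]), ([9],[]),
    ([11],[]), ([4],[23]), ([7],[]), ([8],[]), ([4],[17]), ([9],[]), ([4],[23]), ([11],[])],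
  [([34],[]), ([2],[41]), ([2],[42]), ([2],[42]), ([0],[]), ([2],[41]), ([0],[]), ([22],[14]),
    ([2],[45]), ([22],[14]), ([2],[45]), ([26],[14]), ([2],[44]), ([26],[14]), ([2],[44]),
    ([22],[13]), ([5],[]), ([22],[13]), ([5],[]), ([34],[14]), ([22],[1]), ([26],[1]),
    ([34],[14]), ([22],[1]), ([26],[1]), ([2],[19]), ([6],[]), ([7],[]), ([2],[31]), ([10],[]),
    ([9],[]), ([2],[19]), ([6],[]), ([7],[]), ([2],[31]), ([9],[]), ([10],[])],
  [([16],[15]), ([17],[15]), ([17],[15]), ([19],[15]), ([16],[15]), ([19],[15]), ([22],[15]),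
    ([23],[15]), ([22],[15]), ([23],[15]), ([26],[15]), ([27],[15]), ([26],[15]), ([27],[15]),
    ([30],[15]), ([31],[15]), ([30],[15]), ([31],[15]), ([],[14]), ([],[12]), ([],[13]),
    ([],[14]), ([],[12]), ([],[13]), ([],[11]), ([],[9]), ([],[10]), ([],[8]), ([],[7]), ([],[6]),
    ([],[11]), ([],[9]), ([],[10]), ([],[8]), ([],[6]), ([],[7])],
  [([3],[4]), ([3],[4]), ([3],[2]), ([],[]), ([3],[2]), ([6],[12]), ([6],[9]), ([6],[12]),
    ([6],[9]), ([5],[1]), ([5],[0]), ([5],[1]), ([5],[0]), ([8],[12]), ([8],[9]), ([8],[12]),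
    ([8],[9]), ([6],[1]), ([35],[16]), ([8],[1]), ([6],[1]), ([35],[16]), ([8],[1]), ([6],[0]),
    ([41],[16]), ([8],[0]), ([15],[4]), ([35],[26]), ([15],[2]), ([6],[0]), ([41],[16]),
    ([8],[0]), ([15],[4]), ([15],[2]), ([35],[26])],
  [([],[]), ([4],[2]), ([4],[3]), ([4],[2]), ([5],[1]), ([5],[0]), ([5],[1]), ([5],[0]),
    ([7],[13]), ([7],[10]), ([7],[13]), ([7],[10]), ([8],[13]), ([8],[10]), ([8],[13]),
    ([8],[10]), ([7],[1]), ([8],[1]), ([36],[17]), ([7],[1]), ([8],[1]), ([36],[17]), ([7],[0]),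
    ([8],[0]), ([42],[17]), ([15],[3]), ([15],[2]), ([36],[22]), ([7],[0]), ([8],[0]),
    ([42],[17]), ([15],[3]), ([36],[22]), ([15],[2])],
  [([4],[2]), ([4],[3]), ([4],[2]), ([5],[1]), ([5],[0]), ([5],[1]), ([5],[0]), ([7],[13]),
    ([7],[10]), ([7],[13]), ([7],[10]), ([8],[13]), ([8],[10]), ([8],[13]), ([8],[10]), ([7],[1]),
    ([8],[1]), ([36],[17]), ([7],[1]), ([8],[1]), ([36],[17]), ([7],[0]), ([8],[0]), ([42],[17]),
    ([15],[3]), ([15],[2]), ([36],[22]), ([7],[0]), ([8],[0]), ([42],[17]), ([15],[3]),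
    ([36],[22]), ([15],[2])],
  [([2],[3]), ([],[]), ([6],[14]), ([6],[11]), ([6],[14]), ([6],[11]), ([7],[14]), ([7],[11]),
    ([7],[14]), ([7],[11]), ([5],[1]), ([5],[0]), ([5],[1]), ([5],[0]), ([34],[19]), ([6],[1]),
    ([7],[1]), ([34],[19]), ([6],[1]), ([7],[1]), ([40],[19]), ([6],[0]), ([7],[0]), ([34],[30]),
    ([15],[4]), ([15],[3]), ([40],[19]), ([6],[0]), ([7],[0]), ([34],[30]), ([15],[3]),
    ([15],[4])],
  [([3],[2]), ([6],[12]), ([6],[9]), ([6],[12]), ([6],[9]), ([5],[1]), ([5],[0]), ([5],[1]),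
    ([5],[0]), ([8],[12]), ([8],[9]), ([8],[12]), ([8],[9]), ([6],[1]), ([35],[16]), ([8],[1]),
    ([6],[1]), ([35],[16]), ([8],[1]), ([6],[0]), ([41],[16]), ([8],[0]), ([15],[4]), ([35],[26]),
    ([15],[2]), ([6],[0]), ([41],[16]), ([8],[0]), ([15],[4]), ([15],[2]), ([35],[26])],
  [([6],[14]), ([6],[11]), ([6],[14]), ([6],[11]), ([7],[14]), ([7],[11]), ([7],[14]), ([7],[11]),
    ([5],[1]), ([5],[0]), ([5],[1]), ([5],[0]), ([34],[19]), ([6],[1]), ([7],[1]), ([34],[19]),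
    ([6],[1]), ([7],[1]), ([40],[19]), ([6],[0]), ([7],[0]), ([34],[30]), ([15],[4]), ([15],[3]),
    ([40],[19]), ([6],[0]), ([7],[0]), ([34],[30]), ([15],[3]), ([15],[4])],
  [([1],[0]), ([],[]), ([1],[0]), ([4],[3]), ([12],[10]), ([4],[3]), ([12],[10]), ([4],[2]),
    ([14],[10]), ([4],[2]), ([14],[10]), ([15],[3]), ([15],[2]), ([36],[22]), ([15],[3]),
    ([15],[2]), ([36],[22]), ([12],[0]), ([14],[0]), ([42],[22]), ([12],[5]), ([14],[5]),
    ([45],[22]), ([12],[0]), ([14],[0]), ([42],[22]), ([12],[5]), ([45],[22]), ([14],[5])],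
  [([0],[1]), ([],[]), ([9],[13]), ([4],[3]), ([9],[13]), ([4],[3]), ([11],[13]), ([4],[2]),
    ([11],[13]), ([4],[2]), ([9],[1]), ([11],[1]), ([36],[23]), ([9],[1]), ([11],[1]),
    ([36],[23]), ([15],[3]), ([15],[2]), ([36],[22]), ([9],[5]), ([11],[5]), ([45],[23]),
    ([15],[3]), ([15],[2]), ([36],[22]), ([9],[5]), ([45],[23]), ([11],[5])],
  [([1],[0]), ([4],[3]), ([12],[10]), ([4],[3]), ([12],[10]), ([4],[2]), ([14],[10]), ([4],[2]),
    ([14],[10]), ([15],[3]), ([15],[2]), ([36],[22]), ([15],[3]), ([15],[2]), ([36],[22]),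
    ([12],[0]), ([14],[0]), ([42],[22]), ([12],[5]), ([14],[5]), ([45],[22]), ([12],[0]),
    ([14],[0]), ([42],[22]), ([12],[5]), ([45],[22]), ([14],[5])],
  [([9],[13]), ([4],[3]), ([9],[13]), ([4],[3]), ([11],[13]), ([4],[2]), ([11],[13]), ([4],[2]),
    ([9],[1]), ([11],[1]), ([36],[23]), ([9],[1]), ([11],[1]), ([36],[23]), ([15],[3]),
    ([15],[2]), ([36],[22]), ([9],[5]), ([11],[5]), ([45],[23]), ([15],[3]), ([15],[2]),
    ([36],[22]), ([9],[5]), ([45],[23]), ([11],[5])],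
  [([1],[0]), ([],[]), ([1],[0]), ([3],[2]), ([14],[9]), ([3],[2]), ([14],[9]), ([15],[4]),
    ([35],[26]), ([15],[2]), ([15],[4]), ([35],[26]), ([15],[2]), ([13],[0]), ([41],[26]),
    ([14],[0]), ([13],[5]), ([44],[26]), ([14],[5]), ([13],[0]), ([41],[26]), ([14],[0]),
    ([13],[5]), ([14],[5]), ([44],[26])],
  [([0],[1]), ([],[]), ([11],[12]), ([3],[2]), ([11],[12]), ([3],[2]), ([10],[1]), ([35],[27]),
    ([11],[1]), ([10],[1]), ([35],[27]), ([11],[1]), ([15],[4]), ([35],[26]), ([15],[2]),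
    ([10],[5]), ([44],[27]), ([11],[5]), ([15],[4]), ([35],[26]), ([15],[2]), ([10],[5]),
    ([11],[5]), ([44],[27])],
  [([1],[0]), ([3],[2]), ([14],[9]), ([3],[2]), ([14],[9]), ([15],[4]), ([35],[26]), ([15],[2]),
    ([15],[4]), ([35],[26]), ([15],[2]), ([13],[0]), ([41],[26]), ([14],[0]), ([13],[5]),
    ([44],[26]), ([14],[5]), ([13],[0]), ([41],[26]), ([14],[0]), ([13],[5]), ([14],[5]),
    ([44],[26])],
  [([11],[12]), ([3],[2]), ([11],[12]), ([3],[2]), ([10],[1]), ([35],[27]), ([11],[1]),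
    ([10],[1]), ([35],[27]), ([11],[1]), ([15],[4]), ([35],[26]), ([15],[2]), ([10],[5]),
    ([44],[27]), ([11],[5]), ([15],[4]), ([35],[26]), ([15],[2]), ([10],[5]), ([11],[5]),
    ([44],[27])],
  [([1],[0]), ([],[]), ([1],[0]), ([34],[30]), ([15],[4]), ([15],[3]), ([34],[30]), ([15],[4]),
    ([15],[3]), ([40],[30]), ([13],[0]), ([12],[0]), ([43],[30]), ([13],[5]), ([12],[5]),
    ([40],[30]), ([13],[0]), ([12],[0]), ([43],[30]), ([12],[5]), ([13],[5])],
  [([0],[1]), ([],[]), ([34],[31]), ([10],[1]), ([9],[1]), ([34],[31]), ([10],[1]), ([9],[1]),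
    ([34],[30]), ([15],[4]), ([15],[3]), ([43],[31]), ([10],[5]), ([9],[5]), ([34],[30]),
    ([15],[4]), ([15],[3]), ([43],[31]), ([9],[5]), ([10],[5])],
  [([1],[0]), ([34],[30]), ([15],[4]), ([15],[3]), ([34],[30]), ([15],[4]), ([15],[3]),
    ([40],[30]), ([13],[0]), ([12],[0]), ([43],[30]), ([13],[5]), ([12],[5]), ([40],[30]),
    ([13],[0]), ([12],[0]), ([43],[30]), ([12],[5]), ([13],[5])],
  [([34],[31]), ([10],[1]), ([9],[1]), ([34],[31]), ([10],[1]), ([9],[1]), ([34],[30]),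
    ([15],[4]), ([15],[3]), ([43],[31]), ([10],[5]), ([9],[5]), ([34],[30]), ([15],[4]),
    ([15],[3]), ([43],[31]), ([9],[5]), ([10],[5])],
  [([3],[2]), ([4],[2]), ([],[]), ([3],[2]), ([4],[2]), ([1],[0]), ([14],[9]), ([14],[10]),
    ([1],[5]), ([14],[7]), ([14],[6]), ([1],[0]), ([14],[9]), ([14],[10]), ([1],[5]), ([14],[6]),
    ([14],[7])],
  [([4],[3]), ([2],[3]), ([],[]), ([4],[3]), ([12],[11]), ([1],[0]), ([12],[10]), ([12],[8]),
    ([1],[5]), ([12],[6]), ([12],[11]), ([1],[0]), ([12],[10]), ([12],[8]), ([12],[6]), ([1],[5])],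
  [([2],[4]), ([3],[4]), ([],[]), ([13],[11]), ([13],[9]), ([1],[0]), ([13],[8]), ([13],[7]),
    ([1],[5]), ([13],[11]), ([13],[9]), ([1],[0]), ([13],[8]), ([1],[5]), ([13],[7])],
  [([3],[2]), ([4],[2]), ([1],[0]), ([14],[9]), ([14],[10]), ([1],[5]), ([14],[7]), ([14],[6]),
    ([1],[0]), ([14],[9]), ([14],[10]), ([1],[5]), ([14],[6]), ([14],[7])],
  [([4],[3]), ([12],[11]), ([1],[0]), ([12],[10]), ([12],[8]), ([1],[5]), ([12],[6]), ([12],[11]),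
    ([1],[0]), ([12],[10]), ([12],[8]), ([12],[6]), ([1],[5])],
  [([13],[11]), ([13],[9]), ([1],[0]), ([13],[8]), ([13],[7]), ([1],[5]), ([13],[11]), ([13],[9]),
    ([1],[0]), ([13],[8]), ([1],[5]), ([13],[7])],
  [([3],[2]), ([4],[2]), ([0],[5]), ([11],[7]), ([11],[6]), ([],[]), ([3],[2]), ([4],[2]),
    ([0],[5]), ([11],[6]), ([11],[7])],
  [([4],[3]), ([9],[8]), ([0],[5]), ([9],[6]), ([2],[3]), ([],[]), ([4],[3]), ([9],[8]),
    ([9],[6]), ([0],[5])],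
  [([10],[8]), ([10],[7]), ([0],[5]), ([2],[4]), ([3],[4]), ([],[]), ([10],[8]), ([0],[5]),
    ([10],[7])],
  [([3],[2]), ([4],[2]), ([5],[0]), ([8],[9]), ([8],[10]), ([],[]), ([4],[2]), ([3],[2])],
  [([4],[3]), ([7],[11]), ([5],[0]), ([7],[10]), ([2],[3]), ([4],[3]), ([],[])],
  [([6],[11]), ([6],[9]), ([5],[0]), ([2],[4]), ([],[]), ([3],[4])],
  [([3],[2]), ([4],[2]), ([0],[5]), ([11],[6]), ([11],[7])],
  [([4],[3]), ([9],[8]), ([9],[6]), ([0],[5])],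
  [([10],[8]), ([0],[5]), ([10],[7])],
  [([4],[2]), ([3],[2])],
  [([3],[4])],
  []]

/-- A convenient ordering of the variables for the enumeration of the faces. -/
def perm : List ℕ := [10,0,12,14,13,6,4,15,2,3,5,1,7,11,8,9]

/-- The supports of the leading monomials, with the variables reordered. -/
def nonfaces : List (List ℕ) := rules.map fun p => perm.map fun i => p.1.getD i 0

theorem chk_spairs : spairs rules rules certs = true := by decide +kernel
theorem chk_walks : walksOk gens rules paths = true := by decide +kernel
theorem chk_gens : ∀ p ∈ gens, p ∈ rules ∨ (p.2, p.1) ∈ rules := by decide +kernel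
theorem chk_wt : ∀ p ∈ rules, ∑ i : Fin 16, wt.getD i 0 * p.2.getD i 0
    < ∑ i : Fin 16, wt.getD i 0 * p.1.getD i 0 := by decide +kernel
theorem chk_deg : ∀ p ∈ rules, ∑ i : Fin 16, p.2.getD i 0 = ∑ i : Fin 16, p.1.getD i 0 := by
  decide +kernel
theorem chk_sqfree : ∀ p ∈ rules, ∀ i : Fin 16, p.1.getD i 0 ≤ 1 := by decide +kernel
theorem chk_faces : leq (faces 16 nonfaces)
    [1, 16, 120, 544, 1621, 3228, 4290, 3756, 2088, 672, 96] = true := by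
  decide +kernel

/-! ### Correctness of the list operations -/

theorem getD_ladd (a b : List ℕ) (i : ℕ) :
    (ladd a b).getD i 0 = a.getD i 0 + b.getD i 0 := by
  induction a generalizing b i with
  | nil => simp [ladd]
  | cons x a ih =>
    cases b with
    | nil => simp [ladd]
    | cons y b => cases i with
      | zero => simp [ladd]
      | succ i => simpa [ladd] using ih b i

theorem getD_lsub (a b : List ℕ) (i : ℕ) :
    (lsub a b).getD i 0 = a.getD i 0 - b.getD i 0 := by
  induction a generalizing b i with
  | nil => simp [lsub]
  | cons x a ih =>
    cases b with
    | nil => simp [lsub]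
    | cons y b => cases i with
      | zero => simp [lsub]
      | succ i => simpa [lsub] using ih b i

theorem getD_lmax (a b : List ℕ) (i : ℕ) :
    (lmax a b).getD i 0 = max (a.getD i 0) (b.getD i 0) := by
  induction a generalizing b i with
  | nil => simp [lmax]
  | cons x a ih =>
    cases b with
    | nil => simp [lmax]
    | cons y b => cases i with
      | zero => simp [lmax]; omega
      | succ i => simpa [lmax] using ih b i

theorem lle_getD {a b : List ℕ} (hab : lle a b = true) (i : ℕ) :
    a.getD i 0 ≤ b.getD i 0 := by
  induction a generalizing b i with
  | nil => simp
  | cons x a ih =>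
    cases b with
    | nil =>
      simp only [lle, Bool.and_eq_true, Nat.beq_eq] at hab
      cases i with
      | zero => simp [hab.1]
      | succ i => simpa using ih hab.2 i
    | cons y b =>
      simp only [lle, Bool.and_eq_true, Nat.ble_eq] at hab
      cases i with
      | zero => simp [hab.1]
      | succ i => simpa using ih hab.2 i

theorem eq_of_leq {a b : List ℕ} (hab : leq a b = true) : a = b := by
  induction a generalizing b with
  | nil => cases b with
    | nil => rfl
    | cons y b => simp [leq] at hab
  | cons x a ih => cases b with
    | nil => simp [leq] at hab
    | cons y b =>
      simp only [leq, Bool.and_eq_true, Nat.beq_eq] at hab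
      rw [hab.1, ih hab.2]

/-! ### Rewriting of monomials -/

/-- The exponent vector of a list. -/
noncomputable def dec (L : List ℕ) : Fin 16 →₀ ℕ :=
  Finsupp.equivFunOnFinite.symm fun i => L.getD i 0

theorem dec_apply (L : List ℕ) (i : Fin 16) : dec L i = L.getD i 0 := rfl

theorem dec_ladd (a b : List ℕ) : dec (ladd a b) = dec a + dec b := by
  ext i; simp only [dec_apply, getD_ladd, Finsupp.add_apply]

theorem dec_lsub (a b : List ℕ) : dec (lsub a b) = dec a - dec b := by
  ext i; simp only [dec_apply, getD_lsub, Finsupp.tsub_apply]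

theorem dec_lmax (a b : List ℕ) : dec (lmax a b) = dec a ⊔ dec b := by
  ext i; simp only [dec_apply, getD_lmax, Finsupp.sup_apply]

theorem dec_le {a b : List ℕ} (hab : lle a b = true) : dec a ≤ dec b :=
  fun i => lle_getD hab i

/-- One rewriting step by one of the rules. -/
def Red (a b : Fin 16 →₀ ℕ) : Prop :=
  ∃ p ∈ rules, ∃ c, a = c + dec p.1 ∧ b = c + dec p.2

/-- Iterated rewriting. -/
abbrev Reds := Relation.ReflTransGen Red

theorem Red.add {a b : Fin 16 →₀ ℕ} (hab : Red a b) (d : Fin 16 →₀ ℕ) : Red (d + a) (d + b) := by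
  obtain ⟨p, hp, c, rfl, rfl⟩ := hab
  exact ⟨p, hp, d + c, by rw [add_assoc], by rw [add_assoc]⟩

theorem Reds.add {a b : Fin 16 →₀ ℕ} (hab : Reds a b) (d : Fin 16 →₀ ℕ) :
    Reds (d + a) (d + b) := by
  induction hab with
  | refl => exact .refl
  | tail _ hr ih => exact ih.tail (hr.add d)

theorem red_of_lle {p : List ℕ × List ℕ} (hp : p ∈ rules) {a : List ℕ} (hl : lle p.1 a = true) :
    Red (dec a) (dec (ladd (lsub a p.1) p.2)) := by
  refine ⟨p, hp, dec a - dec p.1, ?_, ?_⟩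
  · rw [tsub_add_cancel_of_le (dec_le hl)]
  · rw [dec_ladd, dec_lsub]

theorem reds_sound (ks a : List ℕ) : Reds (dec a) (dec (reds rules ks a)) := by
  induction ks generalizing a with
  | nil => exact .refl
  | cons k ks ih =>
    rw [reds]
    split
    · exact .refl
    · rename_i p hp
      cases hl : lle p.1 a with
      | false => exact .refl
      | true => exact .head (red_of_lle (List.mem_of_getElem? hp) hl) (ih _)

/-- Two monomials have a common reduct. -/
def Joins (a b : Fin 16 →₀ ℕ) : Prop := ∃ d, Reds a d ∧ Reds b d

theorem Joins.symm {a b : Fin 16 →₀ ℕ} (hab : Joins a b) : Joins b a := by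
  obtain ⟨d, h1, h2⟩ := hab
  exact ⟨d, h2, h1⟩

/-- The S-pair of `p` and `q` is joinable. -/
def SJoins (p q : List ℕ × List ℕ) : Prop :=
  Joins (dec p.1 ⊔ dec q.1 - dec p.1 + dec p.2) (dec p.1 ⊔ dec q.1 - dec q.1 + dec q.2)

theorem SJoins.symm {p q : List ℕ × List ℕ} (hh : SJoins p q) : SJoins q p := by
  have := Joins.symm hh
  rwa [SJoins, sup_comm]

theorem spair_sound {p q c : List ℕ × List ℕ} (hs : spair rules p q c = true) : SJoins p q := by
  have h0 := eq_of_leq hs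
  have h1 := reds_sound c.1 (ladd (lsub (lmax p.1 q.1) p.1) p.2)
  have h2 := reds_sound c.2 (ladd (lsub (lmax p.1 q.1) q.1) q.2)
  rw [← h0] at h2
  simp only [dec_ladd _ p.2, dec_ladd _ q.2, dec_lsub, dec_lmax] at h1 h2
  exact ⟨_, h1, h2⟩

theorem sprow_sound {p : List ℕ × List ℕ} {S cs : List (List ℕ × List ℕ)}
    (hs : sprow rules p S cs = true) : ∀ q ∈ S, SJoins p q := by
  induction S generalizing cs with
  | nil => simp
  | cons q S ih =>
    cases cs with
    | nil => simp [sprow] at hs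
    | cons c cs =>
      simp only [sprow, Bool.and_eq_true] at hs
      intro r hr
      rcases List.mem_cons.1 hr with rfl | hr
      · exact spair_sound hs.1
      · exact ih hs.2 r hr

theorem sjoins_self (p : List ℕ × List ℕ) : SJoins p p := ⟨_, .refl, .refl⟩

theorem spairs_sound {S : List (List ℕ × List ℕ)} {cs : List (List (List ℕ × List ℕ))}
    (hs : spairs rules S cs = true) : ∀ p ∈ S, ∀ q ∈ S, SJoins p q := by
  induction S generalizing cs with
  | nil => simp
  | cons r S ih =>
    cases cs with
    | nil => simp [spairs] at hs
    | cons c cs =>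
      simp only [spairs, Bool.and_eq_true] at hs
      intro p hp q hq
      rcases List.mem_cons.1 hp with hp1 | hp1 <;> rcases List.mem_cons.1 hq with hq1 | hq1
      · rw [hp1, hq1]; exact sjoins_self _
      · rw [hp1]; exact sprow_sound hs.1 q hq1
      · rw [hq1]; exact (sprow_sound hs.1 p hp1).symm
      · exact ih hs.2 p hp1 q hq1

theorem locally_confluent {a b c : Fin 16 →₀ ℕ} (hb : Red a b) (hc : Red a c) : Joins b c := by
  obtain ⟨p, hp, u, rfl, rfl⟩ := hb
  obtain ⟨q, hq, v, huv, rfl⟩ := hc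
  obtain ⟨d, h1, h2⟩ := spairs_sound chk_spairs p hp q hq
  have hle : dec p.1 ⊔ dec q.1 ≤ u + dec p.1 := by
    refine sup_le le_add_self ?_
    rw [huv]; exact le_add_self
  obtain ⟨w, hw⟩ := exists_add_of_le hle
  have e1 : u = w + (dec p.1 ⊔ dec q.1 - dec p.1) := by
    ext i
    have := DFunLike.congr_fun hw i
    simp only [Finsupp.add_apply, Finsupp.sup_apply, Finsupp.tsub_apply] at this ⊢
    have := le_max_left (dec p.1 i) (dec q.1 i)
    omega
  have e2 : v = w + (dec p.1 ⊔ dec q.1 - dec q.1) := by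
    ext i
    have := DFunLike.congr_fun hw i
    have := DFunLike.congr_fun huv i
    simp only [Finsupp.add_apply, Finsupp.sup_apply, Finsupp.tsub_apply] at *
    have := le_max_right (dec p.1 i) (dec q.1 i)
    omega
  refine ⟨w + d, ?_, ?_⟩
  · rw [e1, add_assoc]; exact Reds.add h1 w
  · rw [e2, add_assoc]; exact Reds.add h2 w

/-- The weight which decreases under rewriting. -/
def wtF (a : Fin 16 →₀ ℕ) : ℕ := ∑ i : Fin 16, wt.getD i 0 * a i

theorem wtF_add (a b : Fin 16 →₀ ℕ) : wtF (a + b) = wtF a + wtF b := by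
  simp [wtF, mul_add, Finset.sum_add_distrib]

theorem Red.wt_lt {a b : Fin 16 →₀ ℕ} (hab : Red a b) : wtF b < wtF a := by
  obtain ⟨p, hp, c, rfl, rfl⟩ := hab
  rw [wtF_add, wtF_add]
  exact Nat.add_lt_add_left (chk_wt p hp) _

theorem confluent (n : ℕ) : ∀ a, wtF a < n → ∀ b c, Reds a b → Reds a c → Joins b c := by
  induction n with
  | zero => intro a ha; omega
  | succ n ih =>
    intro a ha b c hb hc
    rcases Relation.ReflTransGen.cases_head hb with rfl | ⟨b', hb', hb⟩
    · exact ⟨c, hc, .refl⟩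
    rcases Relation.ReflTransGen.cases_head hc with rfl | ⟨c', hc', hc⟩
    · exact ⟨b, .refl, .head hb' hb⟩
    obtain ⟨d, hd1, hd2⟩ := locally_confluent hb' hc'
    have hb'' := hb'.wt_lt
    have hc'' := hc'.wt_lt
    obtain ⟨e, he1, he2⟩ := ih b' (by omega) b d hb hd1
    obtain ⟨f, hf1, hf2⟩ := ih c' (by omega) e c (hd2.trans he2) hc
    exact ⟨f, he1.trans hf1, hf2⟩

/-- Standard monomials: not divisible by any leading monomial. -/
def Std (a : Fin 16 →₀ ℕ) : Prop := ∀ p ∈ rules, ¬ dec p.1 ≤ a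

theorem Std.eq {a b : Fin 16 →₀ ℕ} (ha : Std a) (hab : Reds a b) : b = a := by
  rcases Relation.ReflTransGen.cases_head hab with rfl | ⟨c, ⟨p, hp, d, rfl, -⟩, -⟩
  · rfl
  · exact absurd le_add_self (ha p hp)

theorem exists_nf (n : ℕ) : ∀ a, wtF a < n → ∃ b, Reds a b ∧ Std b := by
  induction n with
  | zero => intro a ha; omega
  | succ n ih =>
    intro a ha
    by_cases hs : Std a
    · exact ⟨a, .refl, hs⟩
    · simp only [Std, not_forall, not_not] at hs
      obtain ⟨p, hp, hle⟩ := hs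
      have hr : Red a (a - dec p.1 + dec p.2) :=
        ⟨p, hp, a - dec p.1, (tsub_add_cancel_of_le hle).symm, rfl⟩
      have := hr.wt_lt
      obtain ⟨b, hb, hb'⟩ := ih _ (show wtF (a - dec p.1 + dec p.2) < n by omega)
      exact ⟨b, .head hr hb, hb'⟩

/-- The normal form. -/
noncomputable def NF (a : Fin 16 →₀ ℕ) : Fin 16 →₀ ℕ :=
  (exists_nf (wtF a + 1) a (Nat.lt_succ_self _)).choose

theorem NF_reds (a : Fin 16 →₀ ℕ) : Reds a (NF a) :=
  (exists_nf (wtF a + 1) a (Nat.lt_succ_self _)).choose_spec.1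

theorem NF_std (a : Fin 16 →₀ ℕ) : Std (NF a) :=
  (exists_nf (wtF a + 1) a (Nat.lt_succ_self _)).choose_spec.2

theorem NF_of_std {a : Fin 16 →₀ ℕ} (ha : Std a) : NF a = a := ha.eq (NF_reds a)

theorem NF_eq {a b : Fin 16 →₀ ℕ} (hab : Red a b) : NF a = NF b := by
  obtain ⟨d, h1, h2⟩ := confluent (wtF a + 1) a (Nat.lt_succ_self _) (NF a) (NF b) (NF_reds a)
    (.head hab (NF_reds b))
  rw [← (NF_std a).eq h1, (NF_std b).eq h2]

theorem Red.degree {a b : Fin 16 →₀ ℕ} (hab : Red a b) : b.degree = a.degree := by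
  obtain ⟨p, hp, c, rfl, rfl⟩ := hab
  rw [map_add, map_add, Finsupp.degree_eq_sum (dec p.1), Finsupp.degree_eq_sum (dec p.2)]
  exact congrArg _ (chk_deg p hp)

theorem NF_degree (a : Fin 16 →₀ ℕ) : (NF a).degree = a.degree := by
  have : ∀ b, Reds a b → b.degree = a.degree := by
    intro b hb
    induction hb with
    | refl => rfl
    | tail _ h1 ih => rw [h1.degree, ih]
  exact this _ (NF_reds a)

/-! ### The ideal and the normal form map -/

theorem monomial_dec (L : List ℕ) :
    (monomial (dec L) (1 : ℂ)) = ∏ i : Fin 16, X i ^ (L.getD i 0) := by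
  rw [monomial_eq, Finsupp.prod_fintype _ _ (by simp)]
  simp [dec_apply]

/-- The binomial of a pair of exponent vectors. -/
noncomputable def bino (p : List ℕ × List ℕ) : MvPolynomial (Fin 16) ℂ :=
  monomial (dec p.1) 1 - monomial (dec p.2) 1

theorem pderiv_W (v : Fin 16) : ∃ p, gens[(v : ℕ)]? = some p ∧
    (pderiv v W = bino p ∨ pderiv v W = - bino p) := by
  fin_cases v <;> refine ⟨_, rfl, ?_⟩ <;>
    simp [W, X₁₃, X₃₅, X₅₈, X₈₁, X₁₄, X₄₆, X₆₈, X₅₇, X₇₂, X₂₃, X₆₇, X₂₄, X₇₁, X₃₆, X₄₅, X₈₂,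
      bino, monomial_dec, Fin.prod_univ_succ, Derivation.leibniz, pderiv_X] <;>
    first | (left; ring1) | (right; ring1)

theorem gens_mem {k : ℕ} {p : List ℕ × List ℕ} (hp : gens[k]? = some p) : bino p ∈ I := by
  have hk : k < 16 := by
    by_contra hk
    rw [List.getElem?_eq_none (by simpa [gens] using hk)] at hp
    simp at hp
  obtain ⟨q, hq, hv⟩ := pderiv_W ⟨k, hk⟩
  have hpq : p = q := by
    have := hp.symm.trans hq
    simpa using this
  have hm : pderiv ⟨k, hk⟩ W ∈ I := Ideal.subset_span ⟨_, rfl⟩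
  subst hpq
  rcases hv with hv | hv
  · rwa [← hv]
  · rw [hv] at hm
    simpa using I.neg_mem hm

/-- Congruence of monomials modulo `I`. -/
def Cong (a b : Fin 16 →₀ ℕ) : Prop :=
  (monomial a (1 : ℂ)) - monomial b 1 ∈ I

theorem Cong.refl (a : Fin 16 →₀ ℕ) : Cong a a := by simp [Cong]

theorem Cong.trans {a b c : Fin 16 →₀ ℕ} (h1 : Cong a b) (h2 : Cong b c) : Cong a c := by
  have := I.add_mem h1 h2
  simpa [Cong] using this

theorem Cong.symm {a b : Fin 16 →₀ ℕ} (h1 : Cong a b) : Cong b a := by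
  have := I.neg_mem h1
  simpa [Cong] using this

theorem Cong.add {a b : Fin 16 →₀ ℕ} (h1 : Cong a b) (c : Fin 16 →₀ ℕ) :
    Cong (c + a) (c + b) := by
  have := I.mul_mem_left (monomial c 1) h1
  simpa [Cong, mul_sub, monomial_mul] using this

theorem cong_move {x y a : List ℕ} (hxy : Cong (dec x) (dec y)) (hl : lle x a = true) :
    Cong (dec a) (dec (ladd (lsub a x) y)) := by
  have := hxy.add (dec a - dec x)
  rwa [tsub_add_cancel_of_le (dec_le hl), ← dec_lsub, ← dec_ladd] at this

theorem walk_sound (ks : List ℕ) {a b : List ℕ} (hw : walk gens ks a = some b) :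
    Cong (dec a) (dec b) := by
  induction ks generalizing a with
  | nil =>
    simp only [walk, Option.some.injEq] at hw
    rw [hw]; exact .refl _
  | cons k ks ih =>
    rw [walk] at hw
    split at hw
    · simp at hw
    · rename_i p hp
      have hpI : Cong (dec p.1) (dec p.2) := gens_mem hp
      cases hk : Nat.beq (k % 2) 0 with
      | true =>
        rw [hk, cond_true] at hw
        cases hl : lle p.1 a with
        | true =>
          rw [hl, cond_true] at hw
          exact (cong_move hpI hl).trans (ih hw)
        | false => rw [hl, cond_false] at hw; simp at hw
      | false =>
        rw [hk, cond_false] at hw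
        cases hl : lle p.2 a with
        | true =>
          rw [hl, cond_true] at hw
          exact (cong_move hpI.symm hl).trans (ih hw)
        | false => rw [hl, cond_false] at hw; simp at hw

theorem walksOk_sound {R : List (List ℕ × List ℕ)} {ks : List (List ℕ)}
    (hw : walksOk gens R ks = true) : ∀ p ∈ R, Cong (dec p.1) (dec p.2) := by
  induction R generalizing ks with
  | nil => simp
  | cons q R ih =>
    cases ks with
    | nil => simp [walksOk] at hw
    | cons k ks =>
      simp only [walksOk, Bool.and_eq_true] at hw
      intro p hp
      rcases List.mem_cons.1 hp with hp1 | hp1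
      · rw [hp1]
        have h1 := hw.1
        rw [walkOk] at h1
        split at h1
        · simp at h1
        · rename_i b hb
          rw [← eq_of_leq h1]
          exact walk_sound k hb
      · exact ih hw.2 p hp1

theorem Red.cong {a b : Fin 16 →₀ ℕ} (hab : Red a b) : Cong a b := by
  obtain ⟨p, hp, c, rfl, rfl⟩ := hab
  exact (walksOk_sound chk_walks p hp).add c

theorem NF_cong (a : Fin 16 →₀ ℕ) : Cong a (NF a) := by
  have : ∀ b, Reds a b → Cong a b := by
    intro b hb
    induction hb with
    | refl => exact .refl _
    | tail _ h1 ih => exact ih.trans h1.cong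
  exact this _ (NF_reds a)

/-- The linear map sending each monomial to its normal form. -/
noncomputable def Phi : MvPolynomial (Fin 16) ℂ →ₗ[ℂ] MvPolynomial (Fin 16) ℂ :=
  (basisMonomials (Fin 16) ℂ).constr ℂ fun a => monomial (NF a) 1

theorem Phi_monomial (a : Fin 16 →₀ ℕ) : Phi (monomial a 1) = monomial (NF a) 1 := by
  have := (basisMonomials (Fin 16) ℂ).constr_basis ℂ
    (fun a => (monomial (NF a) 1 : MvPolynomial (Fin 16) ℂ)) a
  simpa [Phi] using this

theorem Phi_bino {p : List ℕ × List ℕ} (hp : p ∈ gens) (q : MvPolynomial (Fin 16) ℂ) :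
    Phi (q * bino p) = 0 := by
  have hN : ∀ a, NF (a + dec p.1) = NF (a + dec p.2) := by
    intro a
    rcases chk_gens p hp with h1 | h1
    · exact NF_eq ⟨p, h1, a, rfl, rfl⟩
    · exact (NF_eq ⟨_, h1, a, rfl, rfl⟩).symm
  induction q using MvPolynomial.induction_on' with
  | monomial a c =>
    have hc : (monomial a c : MvPolynomial (Fin 16) ℂ) = c • monomial a 1 := by
      rw [smul_monomial, smul_eq_mul, mul_one]
    rw [hc, smul_mul_assoc, map_smul, bino, mul_sub, monomial_mul, monomial_mul, map_sub, mul_one,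
      Phi_monomial, Phi_monomial, hN, sub_self, smul_zero]
  | add p q hp hq => rw [add_mul, map_add, hp, hq, add_zero]

theorem Phi_eq_zero {x : MvPolynomial (Fin 16) ℂ} (hx : x ∈ I) : Phi x = 0 := by
  have : ∀ q, Phi (q * x) = 0 := by
    refine Submodule.span_induction (p := fun x _ => ∀ q, Phi (q * x) = 0) ?_ ?_ ?_ ?_ hx
    · rintro _ ⟨v, rfl⟩ q
      obtain ⟨p, hp, hv⟩ := pderiv_W v
      have h0 := Phi_bino (List.mem_of_getElem? hp) q
      rcases hv with hv | hv
      · simp only [hv, h0]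
      · simp only [hv, mul_neg, map_neg, h0, neg_zero]
    · simp
    · intro x y _ _ h1 h2 q
      rw [mul_add, map_add, h1, h2, add_zero]
    · intro a x _ h1 q
      rw [smul_eq_mul, ← mul_assoc, h1]
  simpa using this 1

open Classical in
/-- The standard monomials of degree `n`. -/
noncomputable def stdSet (n : ℕ) : Finset (Fin 16 →₀ ℕ) :=
  (Finset.finsuppAntidiag Finset.univ n).filter Std

theorem mem_stdSet {n : ℕ} {a : Fin 16 →₀ ℕ} : a ∈ stdSet n ↔ a.degree = n ∧ Std a := by
  simp [stdSet, Finset.mem_finsuppAntidiag, Finsupp.degree_eq_sum]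

theorem std_indep (n : ℕ) : LinearIndependent ℂ
    (fun a : stdSet n => Ideal.Quotient.mkₐ ℂ I (monomial (a : Fin 16 →₀ ℕ) 1)) := by
  rw [Fintype.linearIndependent_iff]
  intro g hg
  have h1 : (∑ a : stdSet n, g a • (monomial (a : Fin 16 →₀ ℕ) (1 : ℂ))) ∈ I := by
    rw [← Ideal.Quotient.eq_zero_iff_mem, ← Ideal.Quotient.mkₐ_eq_mk ℂ, map_sum]
    simpa only [map_smul] using hg
  have h2 := Phi_eq_zero h1
  rw [map_sum] at h2
  have h3 : ∀ a : stdSet n, Phi (g a • (monomial (a : Fin 16 →₀ ℕ) (1 : ℂ)))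
      = g a • (monomial (a : Fin 16 →₀ ℕ) (1 : ℂ)) := by
    intro a
    rw [map_smul, Phi_monomial, NF_of_std (mem_stdSet.1 a.2).2]
  simp only [h3] at h2
  intro b
  have h4 := congrArg (coeff (b : Fin 16 →₀ ℕ)) h2
  simpa [coeff_sum, coeff_monomial, Subtype.coe_inj] using h4

theorem h_eq (n : ℕ) : h n = (stdSet n).card := by
  have key : (homogeneousSubmodule (Fin 16) ℂ n).map (Ideal.Quotient.mkₐ ℂ I).toLinearMap
      = Submodule.span ℂ (Set.range
        (fun a : stdSet n => Ideal.Quotient.mkₐ ℂ I (monomial (a : Fin 16 →₀ ℕ) 1))) := by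
    apply le_antisymm
    · rw [Submodule.map_le_iff_le_comap]
      intro f hf
      rw [f.as_sum]
      refine Submodule.sum_mem _ fun a ha => ?_
      have hc : (monomial a (coeff a f) : MvPolynomial (Fin 16) ℂ)
        = coeff a f • monomial a 1 := by
        rw [smul_monomial, smul_eq_mul, mul_one]
      rw [hc]
      refine Submodule.smul_mem _ _ ?_
      have hd : a.degree = n := by
        have := (mem_homogeneousSubmodule n f).1 hf (mem_support_iff.1 ha)
        rw [Finsupp.degree_eq_weight_one]; exact this
      refine Submodule.subset_span ⟨⟨NF a, mem_stdSet.2 ⟨by rw [NF_degree, hd], NF_std a⟩⟩, ?_⟩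
      exact (Ideal.Quotient.eq.2 (NF_cong a)).symm
    · rw [Submodule.span_le]
      rintro _ ⟨a, rfl⟩
      refine ⟨monomial (a : Fin 16 →₀ ℕ) 1, ?_, rfl⟩
      exact isHomogeneous_monomial _ (mem_stdSet.1 a.2).1
  rw [h, key, finrank_span_eq_card (std_indep n), Fintype.card_coe]

/-! ### Counting standard monomials -/

/-- A set of variables (as a Boolean function) containing none of the non-faces. -/
def Ok {n : ℕ} (C : List (List ℕ)) (f : Fin n → Bool) : Prop :=
  ∀ c ∈ C, ∃ i : Fin n, c.getD i 0 ≠ 0 ∧ f i = false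

/-- Evaluation of a polynomial given by its list of coefficients. -/
def evalL {A : Type} [CommRing A] (z : A) : List ℕ → A
  | [] => 0
  | x :: a => (x : A) + z * evalL z a

theorem evalL_ladd {A : Type} [CommRing A] (z : A) (a b : List ℕ) :
    evalL z (ladd a b) = evalL z a + evalL z b := by
  induction a generalizing b with
  | nil => simp [ladd, evalL]
  | cons x a ih =>
    cases b with
    | nil => simp [ladd, evalL]
    | cons y b => simp only [ladd, evalL, ih, Nat.cast_add]; ring

theorem evalL_binom {A : Type} [CommRing A] (z : A) (n : ℕ) :
    evalL z (binom n) = (1 + z) ^ n := by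
  induction n with
  | zero => simp [binom, evalL]
  | succ n ih => simp only [binom, evalL_ladd, evalL, ih, Nat.cast_zero]; ring

open Classical in
/-- The face polynomial. -/
noncomputable def faceSum {A : Type} [CommRing A] (z : A) (n : ℕ) (C : List (List ℕ)) : A :=
  ∑ f : Fin n → Bool, if Ok C f then ∏ i, (if f i then z else 1) else 0

theorem mem_dropHd {C : List (List ℕ)} {c : List ℕ} :
    c ∈ dropHd C ↔ ∃ d ∈ C, d.getD 0 0 = 0 ∧ c = d.tail := by
  induction C with
  | nil => simp [dropHd]
  | cons d C ih =>
    have e : d.headD 0 = d.getD 0 0 := by cases d <;> simp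
    rw [dropHd]
    cases hd : Nat.beq (d.headD 0) 0 with
    | true =>
      have h0 : d.getD 0 0 = 0 := by rw [← e]; exact Nat.eq_of_beq_eq_true hd
      simp only [cond_true, List.mem_cons, ih, exists_eq_or_imp, h0, true_and]
    | false =>
      have h0 : ¬ d.getD 0 0 = 0 := by rw [← e]; exact Nat.ne_of_beq_eq_false hd
      simp only [cond_false, List.mem_cons, ih, exists_eq_or_imp, h0, false_and, false_or]

theorem getD_tail (c : List ℕ) (i : ℕ) : c.tail.getD i 0 = c.getD (i + 1) 0 := by
  cases c <;> simp

theorem ok_cons_true {n : ℕ} (C : List (List ℕ)) (f : Fin n → Bool) :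
    Ok C (Fin.cons true f : Fin (n + 1) → Bool) ↔ Ok (C.map List.tail) f := by
  simp [Ok, Fin.exists_fin_succ]

theorem ok_cons_false {n : ℕ} (C : List (List ℕ)) (f : Fin n → Bool) :
    Ok C (Fin.cons false f : Fin (n + 1) → Bool) ↔ Ok (dropHd C) f := by
  simp only [Ok, Fin.exists_fin_succ, mem_dropHd, Fin.cons_zero, Fin.cons_succ, Fin.val_zero,
    Fin.val_succ, and_true]
  constructor
  · rintro hC c ⟨d, hd, h0, rfl⟩
    simp only [getD_tail]
    exact (hC d hd).resolve_left (fun hn => hn h0)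
  · intro hC c hc
    by_cases h0 : c.getD 0 0 = 0
    · right
      simpa only [getD_tail] using hC _ ⟨c, hc, h0, rfl⟩
    · exact Or.inl h0

theorem faceSum_succ {A : Type} [CommRing A] (z : A) (n : ℕ) (C : List (List ℕ)) :
    faceSum z (n + 1) C = faceSum z n (dropHd C) + z * faceSum z n (C.map List.tail) := by
  classical
  unfold faceSum
  rw [← (Fin.consEquiv fun _ : Fin (n + 1) => Bool).sum_comp, Fintype.sum_prod_type,
    Fintype.sum_bool, add_comm, Finset.mul_sum]
  congr 1
  · refine Finset.sum_congr rfl fun f _ => ?_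
    simp [Fin.consEquiv, ok_cons_false, Fin.prod_univ_succ]
  · refine Finset.sum_congr rfl fun f _ => ?_
    simp [Fin.consEquiv, ok_cons_true, Fin.prod_univ_succ]

theorem faceSum_nil {A : Type} [CommRing A] (z : A) (n : ℕ) :
    faceSum z n [] = (1 + z) ^ n := by
  induction n with
  | zero => simp [faceSum, Ok]
  | succ n ih => rw [faceSum_succ, dropHd, List.map_nil, ih]; ring

theorem getD_of_lzero {c : List ℕ} (hc : lzero c = true) (i : ℕ) : c.getD i 0 = 0 := by
  induction c generalizing i with
  | nil => simp
  | cons x c ih =>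
    simp only [lzero, Bool.and_eq_true, Nat.beq_eq] at hc
    cases i with
    | zero => simpa using hc.1
    | succ i => simpa using ih hc.2 i

theorem faces_sound {A : Type} [CommRing A] (z : A) (n : ℕ) (C : List (List ℕ)) :
    faceSum z n C = evalL z (faces n C) := by
  induction n generalizing C with
  | zero =>
    cases C with
    | nil => simp [faceSum_nil, faces, evalL]
    | cons c C =>
      rw [faceSum]
      refine Finset.sum_eq_zero fun f _ => if_neg fun hok => ?_
      obtain ⟨i, -⟩ := hok c List.mem_cons_self
      exact i.elim0
  | succ n ih =>
    rw [faces]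
    cases hC : C.isEmpty with
    | true =>
      rw [List.isEmpty_iff.1 hC, faceSum_nil, cond_true, evalL_binom]
    | false =>
      rw [cond_false]
      cases hz : C.any lzero with
      | true =>
        obtain ⟨c, hc, hc0⟩ := List.any_eq_true.1 hz
        rw [cond_true, evalL, faceSum]
        refine Finset.sum_eq_zero fun f _ => if_neg fun hok => ?_
        obtain ⟨i, hi, -⟩ := hok c hc
        exact hi (getD_of_lzero hc0 _)
      | false =>
        rw [cond_false, evalL_ladd, evalL, faceSum_succ, ih, ih, Nat.cast_zero, zero_add]

/-- The reordering of the variables. -/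
def permF (i : Fin 16) : Fin 16 := Fin.ofNat 16 (perm.getD i 0)

theorem permF_bij : Function.Bijective permF := by
  rw [Fintype.bijective_iff_injective_and_card]
  exact ⟨by unfold Function.Injective; decide +kernel, rfl⟩

theorem perm_spec : ∀ i : Fin 16, perm[(i : ℕ)]? = some (permF i : ℕ) := by decide +kernel

/-- The support pattern of a monomial, in the new ordering. -/
def patt (a : Fin 16 →₀ ℕ) (i : Fin 16) : Bool := !(Nat.beq (a (permF i)) 0)

theorem patt_false (a : Fin 16 →₀ ℕ) (i : Fin 16) : patt a i = false ↔ a (permF i) = 0 := by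
  simp [patt]

theorem std_iff (a : Fin 16 →₀ ℕ) : Std a ↔ Ok nonfaces (patt a) := by
  simp only [Std, Ok, nonfaces, List.mem_map, forall_exists_index, and_imp,
    forall_apply_eq_imp_iff₂]
  refine forall₂_congr fun p hp => ?_
  rw [Finsupp.le_def, not_forall, permF_bij.surjective.exists]
  refine exists_congr fun i => ?_
  have e : (perm.map fun i => p.1.getD i 0).getD i 0 = p.1.getD (permF i) 0 := by
    rw [List.getD_eq_getElem?_getD, List.getElem?_map, perm_spec]
    simp
  rw [e, patt_false, dec_apply]
  have := chk_sqfree p hp (permF i)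
  omega

/-- The power series `t/(1-t)`. -/
noncomputable def zz : PowerSeries ℤ := PowerSeries.mk fun n => if n = 0 then 0 else 1

theorem zz_mul : zz * (1 - PowerSeries.X) = PowerSeries.X := by
  ext n
  rw [mul_sub, mul_one, map_sub]
  cases n with
  | zero => simp [zz]
  | succ n =>
    rw [PowerSeries.coeff_succ_mul_X, zz, PowerSeries.coeff_mk, PowerSeries.coeff_mk,
      PowerSeries.coeff_X]
    cases n <;> simp

theorem coeff_pick (b : Bool) (k : ℕ) :
    PowerSeries.coeff k (if b then zz else 1 : PowerSeries ℤ)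
      = if b = !(Nat.beq k 0) then 1 else 0 := by
  cases b <;> cases k <;> simp [zz, PowerSeries.coeff_one]

theorem hilbert_eq : (PowerSeries.mk fun n => (h n : ℤ)) = faceSum zz 16 nonfaces := by
  classical
  ext n
  rw [PowerSeries.coeff_mk, h_eq, stdSet, faceSum, map_sum, Finset.card_filter, Nat.cast_sum]
  have e : ∀ f : Fin 16 → Bool,
      PowerSeries.coeff n (if Ok nonfaces f then ∏ i, (if f i then zz else 1) else 0)
      = ∑ a ∈ Finset.finsuppAntidiag Finset.univ n,
        if f = patt a then (if Ok nonfaces f then (1 : ℤ) else 0) else 0 := by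
    intro f
    by_cases hf : Ok nonfaces f
    · rw [if_pos hf]
      have hprod : ∏ i, (if f i then zz else 1)
          = ∏ j, (if f ((Equiv.ofBijective _ permF_bij).symm j) then zz else 1) :=
        ((Equiv.ofBijective _ permF_bij).symm.prod_comp fun i => if f i then zz else 1).symm
      rw [hprod, PowerSeries.coeff_prod]
      refine Finset.sum_congr rfl fun a _ => ?_
      rw [← (Equiv.ofBijective _ permF_bij).prod_comp]
      simp only [coeff_pick, Equiv.ofBijective_apply, if_pos hf]
      rw [Finset.prod_ite_zero]
      simp [funext_iff, patt]
    · simp [if_neg hf]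
  simp only [e]
  rw [Finset.sum_comm]
  refine Finset.sum_congr rfl fun a _ => ?_
  rw [Finset.sum_ite_eq' Finset.univ (patt a)]
  simp [std_iff]

/-- The Hilbert series of the master space of `PdP₅` satisfies
`H(t)·(1−t)¹⁰ = 1 + 6t + 21t² + 40t³ + 39t⁴ − 30t⁵ + 19t⁶`, i.e.
`H(t; F♭_{PdP₅}) = (1 + 6t + 21t² + 40t³ + 39t⁴ − 30t⁵ + 19t⁶)/(1−t)¹⁰`; in
particular the master space of `PdP₅` has dimension 10. -/
theorem hilbert_series_PdP5 :
    (PowerSeries.mk fun n => (h n : ℤ)) * (1 - PowerSeries.X) ^ 10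
      = 1 + 6 * PowerSeries.X + 21 * PowerSeries.X ^ 2 + 40 * PowerSeries.X ^ 3
        + 39 * PowerSeries.X ^ 4 - 30 * PowerSeries.X ^ 5
        + 19 * PowerSeries.X ^ 6 := by
  rw [hilbert_eq, faces_sound, eq_of_leq chk_faces]
  have hz := zz_mul
  set z := zz
  have hk : ∀ k, k ≤ 10 → z ^ k * (1 - PowerSeries.X : PowerSeries ℤ) ^ 10
      = PowerSeries.X ^ k * (1 - PowerSeries.X) ^ (10 - k) := by
    intro k hk
    rw [← hz, mul_pow, hz, mul_assoc, ← pow_add]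
    congr 2
    omega
  simp only [evalL]
  push_cast
  have h1 := hk 1 (by norm_num)
  have h2 := hk 2 (by norm_num)
  have h3 := hk 3 (by norm_num)
  have h4 := hk 4 (by norm_num)
  have h5 := hk 5 (by norm_num)
  have h6 := hk 6 (by norm_num)
  have h7 := hk 7 (by norm_num)
  have h8 := hk 8 (by norm_num)
  have h9 := hk 9 (by norm_num)
  have h10 := hk 10 (by norm_num)
  norm_num only at h1 h2 h3 h4 h5 h6 h7 h8 h9 h10
  linear_combination 16 * h1 + 120 * h2 + 544 * h3 + 1621 * h4 + 3228 * h5 + 4290 * h6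
    + 3756 * h7 + 2088 * h8 + 672 * h9 + 96 * h10

end PdP5Hilbert
end
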